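/- (Topological Tverberg theorem for prime powers.) Let d be a positive integer and r a prime power (r = q^m for a prime q and integer m ≥ 1). For every continuous map f from the standard simplex Δ_{(d+1)(r−1)} = stdSimplex ℝ (Fin ((d+1)*(r−1)+1)) to EuclideanSpace ℝ (Fin d) there exist r pairwise disjoint nonempty subsets A₁, …, A_r ⊆ Fin ((d+1)*(r−1)+1) such that the images under f of the faces spanned by A₁, …, A_r have a common point: the intersection over s of f '' {x : ∀ i ∉ A_s, x i = 0} (taken inside the simplex) is nonempty. -/

import Mathlib

namespace TopologicalTverberg

section Chains

open Finsupp

variable (k : Type*) [Field k] {V : Type*}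

/-- Ordered chains: formal combinations of finite sequences of points (the empty one included). -/
abbrev Chain (k : Type*) [Field k] (V : Type*) := List V →₀ k

/-- The join of a point with a chain. -/
noncomputable def cone (v : V) : Chain k V →ₗ[k] Chain k V := lmapDomain k k (List.cons v)

@[simp] lemma cone_single (v : V) (l : List V) (a : k) :
    cone k v (single l a) = single (v :: l) a := by
  simp [cone]

/-- The boundary of a sequence of points in the augmented ordered chain complex. -/
noncomputable def listBoundary : List V → Chain k V
  | [] => 0
  | v :: l => single l 1 - cone k v (listBoundary l)

/-- The boundary operator of the augmented ordered chain complex. -/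
noncomputable def boundary : Chain k V →ₗ[k] Chain k V := linearCombination k (listBoundary k)

@[simp] lemma boundary_nil (a : k) : boundary k (single ([] : List V) a) = 0 := by
  simp [boundary, listBoundary]

lemma boundary_single (l : List V) (a : k) :
    boundary k (single l a) = a • listBoundary k l := by
  simp [boundary]

@[simp] lemma boundary_cone (v : V) (c : Chain k V) :
    boundary k (cone k v c) = c - cone k v (boundary k c) := by
  induction c using Finsupp.induction_linear with
  | zero => simp
  | add x y hx hy => simp only [map_add, hx, hy]; abel
  | single l a =>
    simp [boundary_single, listBoundary, smul_sub]

@[simp] lemma boundary_boundary (c : Chain k V) : boundary k (boundary k c) = 0 := by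
  induction c using Finsupp.induction_linear with
  | zero => simp
  | add x y hx hy => simp [hx, hy]
  | single l a =>
    induction l generalizing a with
    | nil => simp
    | cons v l ih =>
      rw [← cone_single, boundary_cone, map_sub, boundary_cone, ih]
      simp

/-- The map on chains induced by a map of points. -/
noncomputable def pushforward (g : V → V) : Chain k V →ₗ[k] Chain k V :=
  lmapDomain k k (List.map g)

@[simp] lemma pushforward_single (g : V → V) (l : List V) (a : k) :
    pushforward k g (single l a) = single (l.map g) a := by
  simp [pushforward]

lemma pushforward_cone (g : V → V) (v : V) (c : Chain k V) :
    pushforward k g (cone k v c) = cone k (g v) (pushforward k g c) := by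
  induction c using Finsupp.induction_linear with
  | zero => simp
  | add x y hx hy => simp [hx, hy]
  | single l a => simp

lemma pushforward_boundary (g : V → V) (c : Chain k V) :
    pushforward k g (boundary k c) = boundary k (pushforward k g c) := by
  induction c using Finsupp.induction_linear with
  | zero => simp
  | add x y hx hy => simp [hx, hy]
  | single l a =>
    induction l generalizing a with
    | nil => simp
    | cons v l ih =>
      rw [← cone_single, boundary_cone, map_sub, pushforward_cone, pushforward_cone, ih,
        boundary_cone]

variable {k}

lemma linearMap_eq_of_mem_supported {M : Type*} [AddCommGroup M] [Module k M] {S : Set (List V)}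
    {f g : Chain k V →ₗ[k] M} (h : ∀ l ∈ S, f (single l 1) = g (single l 1))
    {c : Chain k V} (hc : c ∈ supported k k S) : f c = g c := by
  rw [supported_eq_span_single] at hc
  refine LinearMap.eqOn_span (f := f) (g := g) ?_ hc
  rintro _ ⟨l, hl, rfl⟩
  exact h l hl

lemma linearMap_mem_of_mem_supported {S : Set (List V)} {M : Type*} [AddCommGroup M] [Module k M]
    {P : Submodule k M} {f : Chain k V →ₗ[k] M} (h : ∀ l ∈ S, f (single l 1) ∈ P)
    {c : Chain k V} (hc : c ∈ supported k k S) : f c ∈ P := by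
  rw [supported_eq_span_single] at hc
  have : Submodule.span k ((fun i => single i (1 : k)) '' S) ≤ P.comap f := by
    rw [Submodule.span_le]
    rintro _ ⟨l, hl, rfl⟩
    exact h l hl
  exact this hc

end Chains

section Subdivision

open Finsupp

variable (k : Type*) [Field k] {V : Type*} (b : List V → V)

/-- The subdivision operator which cones sequences of length `n` from the points given by `b`. -/
noncomputable def subdivision : ℕ → (Chain k V →ₗ[k] Chain k V)
  | 0 => LinearMap.id
  | n + 1 => linearCombination k
      (fun l => cone k (b l) (subdivision n (boundary k (single l 1))))

lemma subdivision_succ_single (n : ℕ) (l : List V) :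
    subdivision k b (n + 1) (single l 1) =
      cone k (b l) (subdivision k b n (boundary k (single l 1))) := by
  simp [subdivision]

lemma boundary_subdivision (n : ℕ) (c : Chain k V) :
    boundary k (subdivision k b (n + 1) c) = subdivision k b n (boundary k c) := by
  suffices h : boundary k ∘ₗ subdivision k b (n + 1) = subdivision k b n ∘ₗ boundary k from
    LinearMap.congr_fun h c
  induction n with
  | zero =>
    ext1 l; ext1
    simp [subdivision]
  | succ n ih =>
    ext1 l; ext1
    have := LinearMap.congr_fun ih (boundary k (single l 1))
    simp only [LinearMap.comp_apply, boundary_boundary, map_zero] at this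
    simp only [LinearMap.comp_apply, lsingle_apply, subdivision_succ_single k b (n + 1),
      boundary_cone, this, map_zero, sub_zero]

lemma boundary_iterate_subdivision (n j : ℕ) (c : Chain k V) :
    boundary k ((subdivision k b (n + 1))^[j] c) = (subdivision k b n)^[j] (boundary k c) := by
  induction j generalizing c with
  | zero => rfl
  | succ j ih => rw [Function.iterate_succ_apply, Function.iterate_succ_apply, ih,
      boundary_subdivision]

lemma pushforward_subdivision (g : V → V) (hg : ∀ l, b (l.map g) = g (b l)) (n : ℕ)
    (c : Chain k V) :
    pushforward k g (subdivision k b n c) = subdivision k b n (pushforward k g c) := by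
  induction n generalizing c with
  | zero => rfl
  | succ n ih =>
    induction c using Finsupp.induction_linear with
    | zero => simp
    | add x y hx hy => simp [hx, hy]
    | single l a =>
      rw [← mul_one a, ← smul_eq_mul, ← Finsupp.smul_single]
      simp only [map_smul, subdivision_succ_single, pushforward_cone, ih, pushforward_single,
        pushforward_boundary, hg]

lemma pushforward_iterate_subdivision (g : V → V) (hg : ∀ l, b (l.map g) = g (b l)) (n j : ℕ)
    (c : Chain k V) :
    pushforward k g ((subdivision k b n)^[j] c) = (subdivision k b n)^[j] (pushforward k g c) := by
  induction j generalizing c with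
  | zero => rfl
  | succ j ih =>
    rw [Function.iterate_succ_apply, Function.iterate_succ_apply, ih,
      pushforward_subdivision k b g hg]

end Subdivision

section Mesh

open Finsupp

variable {k : Type*} [Field k] {E : Type*} [NormedAddCommGroup E] [NormedSpace ℝ E]

/-- The barycenter of a finite sequence of points. -/
noncomputable def barycenter (l : List E) : E := (l.length : ℝ)⁻¹ • l.sum

lemma barycenter_map (g : E →ₗ[ℝ] E) (l : List E) :
    barycenter (l.map g) = g (barycenter l) := by
  simp [barycenter, map_list_sum]

lemma barycenter_mem {C : Set E} (hC : Convex ℝ C) {l : List E} (hl : l ≠ [])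
    (h : ∀ v ∈ l, v ∈ C) : barycenter l ∈ C := by
  have hpos : 0 < l.length := List.length_pos_iff.2 hl
  rw [barycenter, ← Fin.sum_univ_getElem, Finset.smul_sum]
  refine hC.sum_mem (fun _ _ => by positivity) ?_ (fun i _ => h _ (l.getElem_mem _))
  simp [hpos.ne']

lemma dist_barycenter_le {l : List E} {D : ℝ} (h : ∀ u ∈ l, ∀ v ∈ l, dist u v ≤ D)
    {v : E} (hv : v ∈ l) :
    dist v (barycenter l) ≤ ((l.length : ℝ) - 1) / l.length * D := by
  classical
  obtain ⟨i, hi, rfl⟩ := List.getElem_of_mem hv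
  have hpos : (0 : ℝ) < l.length := by exact_mod_cast (Nat.zero_le i).trans_lt hi
  have key : l[i] - barycenter l = (l.length : ℝ)⁻¹ • ∑ j : Fin l.length, (l[i] - l[j]) := by
    rw [Finset.sum_sub_distrib, smul_sub, barycenter, ← Fin.sum_univ_getElem]
    simp [← Nat.cast_smul_eq_nsmul ℝ, smul_smul, hpos.ne']
  have hsum : ‖∑ j : Fin l.length, (l[i] - l[j])‖ ≤ ((l.length : ℝ) - 1) * D := by
    rw [← Finset.sum_erase_add _ _ (Finset.mem_univ (⟨i, hi⟩ : Fin l.length))]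
    simp only [Fin.getElem_fin, sub_self, add_zero]
    refine (norm_sum_le_of_le _ (f := fun j : Fin l.length => l[i] - l[j]) (n := fun _ => D)
      fun j _ => ?_).trans ?_
    · rw [← dist_eq_norm]
      exact h _ (l.getElem_mem _) _ (l.getElem_mem _)
    · rw [Finset.sum_const, Finset.card_erase_of_mem (Finset.mem_univ _)]
      have : 1 ≤ l.length := by omega
      simp [Nat.cast_sub this]
  rw [dist_eq_norm, key, norm_smul, norm_inv, Real.norm_of_nonneg hpos.le, div_mul_eq_mul_div,
    div_eq_inv_mul]
  gcongr

/-- Sequences of `n` points, any two at distance at most `D`, in a common member of a family. -/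
def fineLists (𝒞 : Set (Set E)) (n : ℕ) (D : ℝ) : Set (List E) :=
  {l | l.length = n ∧ (∃ C ∈ 𝒞, ∀ v ∈ l, v ∈ C) ∧ ∀ u ∈ l, ∀ v ∈ l, dist u v ≤ D}

lemma listBoundary_mem_supported {V : Type*} (l : List V) :
    listBoundary k l ∈ supported k k {l' : List V | l'.length + 1 = l.length ∧ l' ⊆ l} := by
  induction l with
  | nil => exact zero_mem _
  | cons v l ih =>
    refine sub_mem (single_mem_supported _ _ ⟨rfl, by simp⟩) ?_
    refine linearMap_mem_of_mem_supported (fun l' hl' => ?_) ih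
    rw [cone_single]
    exact single_mem_supported _ _ ⟨by simp [← hl'.1], List.cons_subset_cons _ hl'.2⟩

lemma subdivision_mem_supported {C : Set E} (hC : Convex ℝ C) {D : ℝ} (hD : 0 ≤ D) {n : ℕ}
    {l : List E} (hl : l ∈ fineLists {C} n D) :
    subdivision k barycenter n (single l 1) ∈
      supported k k (fineLists {C} n (((n : ℝ) - 1) / n * D)) := by
  induction n generalizing l C with
  | zero =>
    obtain ⟨hl0, -, -⟩ := hl
    obtain rfl := List.length_eq_zero_iff.1 hl0
    exact single_mem_supported _ _ ⟨rfl, ⟨C, rfl, by simp⟩, by simp⟩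
  | succ n ih =>
    obtain ⟨hlen, ⟨_, hC', hlC⟩, hlD⟩ := hl
    rw [Set.mem_singleton_iff.1 hC'] at hlC
    set D' := ((n + 1 : ℕ) - 1 : ℝ) / (n + 1 : ℕ) * D with hD'
    have hball : ∀ v ∈ l, v ∈ Metric.closedBall (barycenter l) D' := fun v hv => by
      simpa [hlen, hD'] using dist_barycenter_le hlD hv
    have hne : l ≠ [] := by rintro rfl; simp at hlen
    have hDD : ((n : ℝ) - 1) / n * D ≤ D' := by
      rw [hD']
      gcongr ?_ * D
      rcases Nat.eq_zero_or_pos n with rfl | hn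
      · simp
      · have : (0 : ℝ) < n := by exact_mod_cast hn
        rw [div_le_div_iff₀ this (by positivity)]
        push_cast
        nlinarith
    have hb : barycenter l ∈ C := barycenter_mem hC hne hlC
    rw [subdivision_succ_single]
    refine linearMap_mem_of_mem_supported (f := cone k (barycenter l) ∘ₗ subdivision k barycenter n)
      (fun l' hl' => ?_) (c := boundary k (single l 1))
      (S := {l' | l'.length + 1 = l.length ∧ l' ⊆ l})
      (by simpa [boundary_single] using listBoundary_mem_supported l)
    have := ih (C := C ∩ Metric.closedBall (barycenter l) D')
      (hC.inter (convex_closedBall _ _)) (l := l')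
      ⟨by have := hl'.1; omega, ⟨_, rfl, fun v hv => ⟨hlC _ (hl'.2 hv), hball _ (hl'.2 hv)⟩⟩,
        fun u hu v hv => hlD u (hl'.2 hu) v (hl'.2 hv)⟩
    rw [LinearMap.comp_apply]
    refine linearMap_mem_of_mem_supported (fun l'' hl'' => ?_) this
    obtain ⟨hlen'', ⟨_, hC', hC''⟩, hD''⟩ := hl''
    rw [Set.mem_singleton_iff.1 hC'] at hC''
    rw [cone_single]
    refine single_mem_supported _ _ ⟨by simp [hlen''], ⟨C, rfl, ?_⟩, ?_⟩
    · simpa using ⟨hb, fun v hv => (hC'' v hv).1⟩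
    · have h0 : 0 ≤ D' := dist_nonneg.trans (hball _ (List.head_mem hne))
      simp only [List.mem_cons, forall_eq_or_imp, dist_self]
      refine ⟨⟨h0, fun v hv => ?_⟩, fun u hu => ⟨(hC'' u hu).2, fun v hv => ?_⟩⟩
      · rw [dist_comm]; exact (hC'' v hv).2
      · exact (hD'' u hu v hv).trans hDD

lemma iterate_subdivision_mem_supported {𝒞 : Set (Set E)} (h𝒞 : ∀ C ∈ 𝒞, Convex ℝ C) {D : ℝ}
    (hD : 0 ≤ D) {n : ℕ} (hn : 0 < n) (j : ℕ) {c : Chain k E}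
    (hc : c ∈ supported k k (fineLists 𝒞 n D)) :
    (subdivision k barycenter n)^[j] c ∈
      supported k k (fineLists 𝒞 n ((((n : ℝ) - 1) / n) ^ j * D)) := by
  induction j with
  | zero => simpa using hc
  | succ j ih =>
    rw [Function.iterate_succ_apply']
    refine linearMap_mem_of_mem_supported (fun l hl => ?_) ih
    obtain ⟨hlen, ⟨C, hC𝒞, hlC⟩, hlD⟩ := hl
    have hn' : (1 : ℝ) ≤ n := by exact_mod_cast hn
    have hq : 0 ≤ ((n : ℝ) - 1) / n := div_nonneg (by linarith) (by linarith)
    have := subdivision_mem_supported (k := k) (h𝒞 C hC𝒞) (mul_nonneg (pow_nonneg hq j) hD)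
      (l := l) ⟨hlen, ⟨C, rfl, hlC⟩, hlD⟩
    rw [← mul_assoc, ← pow_succ'] at this
    refine supported_mono ?_ this
    rintro l' ⟨h1, ⟨_, hC', h2⟩, h3⟩
    rw [Set.mem_singleton_iff.1 hC'] at h2
    exact ⟨h1, ⟨C, hC𝒞, h2⟩, h3⟩

end Mesh

section Paths

open Finsupp

variable {k : Type*} [Field k] {V G : Type*} [AddCommGroup G] [Fintype G]
  (e : ℕ → G → V) (f : ℕ → G → k)

/-- The sum of all sequences `e n x, e (n - 1) y, e (n - 2) z, …` ending with a point `e 0 _`,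
weighted by `f n (y - x) * f (n - 1) (z - y) * …`. -/
noncomputable def pathChain : ℕ → G → Chain k V
  | 0, x => single [e 0 x] 1
  | n + 1, x => cone k (e (n + 1) x) (∑ y, f (n + 1) (y - x) • pathChain n y)

lemma pathChain_succ (n : ℕ) (x : G) : pathChain e f (n + 1) x =
    cone k (e (n + 1) x) (∑ y, f (n + 1) (y - x) • pathChain e f n y) := rfl

lemma boundary_pathChain_zero (x : G) : boundary k (pathChain e f 0 x) = single [] 1 := by
  simp [pathChain, boundary_single, listBoundary]

lemma boundary_pathChain_succ (hf : ∀ n, ∑ y, f n y = 0)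
    (hff : ∀ n z, ∑ y, f (n + 1) y * f n (z - y) = 0) (n : ℕ) (x : G) :
    boundary k (pathChain e f (n + 1) x) = ∑ y, f (n + 1) (y - x) • pathChain e f n y := by
  rw [pathChain_succ, boundary_cone, sub_eq_self, ← LinearMap.map_zero (cone k (e (n + 1) x))]
  congr 1
  rw [map_sum]
  simp only [map_smul]
  induction n generalizing x with
  | zero =>
    simp only [boundary_pathChain_zero, ← Finset.sum_smul]
    have := Equiv.sum_comp (Equiv.subRight x) (f (0 + 1))
    simp only [Equiv.subRight_apply] at this
    rw [this, hf, zero_smul]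
  | succ n ih =>
    have h : ∀ y, boundary k (pathChain e f (n + 1) y) =
        ∑ z, f (n + 1) (z - y) • pathChain e f n z := fun y => by
      rw [pathChain_succ, boundary_cone, map_sum]
      simp only [map_smul]
      rw [ih y]
      simp
    simp only [h, Finset.smul_sum, smul_smul]
    rw [Finset.sum_comm]
    refine Finset.sum_eq_zero fun z _ => ?_
    rw [← Finset.sum_smul, ← Equiv.sum_comp (Equiv.addRight x)]
    convert zero_smul k _
    rw [← hff (n + 1) (z - x)]
    simp [sub_sub, add_comm]

lemma pushforward_pathChain {T : V → V} {g : G} (hT : ∀ i x, T (e i x) = e i (x + g)) (n : ℕ)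
    (x : G) : pushforward k T (pathChain e f n x) = pathChain e f n (x + g) := by
  induction n generalizing x with
  | zero => simp [pathChain, hT]
  | succ n ih =>
    simp only [pathChain_succ, pushforward_cone, hT, map_sum, map_smul, ih]
    rw [← Equiv.sum_comp (Equiv.addRight g) (fun y => f (n + 1) (y - (x + g)) •
      cone k (e (n + 1) (x + g)) (pathChain e f n y))]
    simp

lemma pathChain_mem_supported (n : ℕ) (x : G) : pathChain e f n x ∈ supported k k
    {l | l.length = n + 1 ∧ ∃ c : ℕ → G, ∀ v ∈ l, ∃ i ≤ n, v = e i (c i)} := by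
  classical
  induction n generalizing x with
  | zero => exact single_mem_supported _ _ ⟨rfl, fun _ => x, by simp⟩
  | succ n ih =>
    rw [pathChain_succ]
    refine linearMap_mem_of_mem_supported (fun l hl => ?_)
      (Submodule.sum_mem _ fun y _ => Submodule.smul_mem _ _ (ih y))
    obtain ⟨hlen, c, hc⟩ := hl
    rw [cone_single]
    refine single_mem_supported _ _ ⟨by simp [hlen], Function.update c (n + 1) x, ?_⟩
    simp only [List.mem_cons, forall_eq_or_imp]
    refine ⟨⟨n + 1, le_rfl, by simp⟩, fun v hv => ?_⟩
    obtain ⟨i, hi, rfl⟩ := hc v hv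
    exact ⟨i, by omega, by rw [Function.update_of_ne (by omega)]⟩

end Paths

section Cochains

open Finsupp

variable {k : Type*} [Field k] {V : Type*}

/-- The cup product of the 0-cochain `φ` with the cochain `c`. -/
noncomputable def cupZero (φ : V → k) (c : Chain k V →ₗ[k] k) : Chain k V →ₗ[k] k :=
  linearCombination k fun
    | [] => 0
    | u :: l => φ u * c (single (u :: l) 1)

/-- The cup product of the 1-cochain `τ` with the cochain `c`. -/
noncomputable def cupOne (τ : V → V → k) (c : Chain k V →ₗ[k] k) : Chain k V →ₗ[k] k :=
  linearCombination k fun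
    | u :: v :: l => τ u v * c (single (v :: l) 1)
    | _ => 0

variable {c : Chain k V →ₗ[k] k} {K : Set V}

lemma cupZero_nil (φ : V → k) (a : k) : cupZero φ c (single [] a) = 0 := by
  simp [cupZero]

lemma cupZero_cons (φ : V → k) (u : V) (l : List V) :
    cupZero φ c (single (u :: l) 1) = φ u * c (single (u :: l) 1) := by
  simp [cupZero]

lemma cupOne_nil (τ : V → V → k) (a : k) : cupOne τ c (single [] a) = 0 := by
  simp [cupOne]

lemma cupOne_singleton (τ : V → V → k) (u : V) (a : k) : cupOne τ c (single [u] a) = 0 := by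
  simp [cupOne]

lemma cupOne_cons (τ : V → V → k) (u v : V) (l : List V) :
    cupOne τ c (single (u :: v :: l) 1) = τ u v * c (single (v :: l) 1) := by
  simp [cupOne]

lemma cupZero_cone (φ : V → k) (u : V) (x : Chain k V) :
    cupZero φ c (cone k u x) = φ u * c (cone k u x) := by
  suffices h : cupZero φ c ∘ₗ cone k u = φ u • (c ∘ₗ cone k u) from LinearMap.congr_fun h x
  ext l
  simp [cupZero_cons]

lemma cupOne_cone_cone (τ : V → V → k) (u v : V) (x : Chain k V) :
    cupOne τ c (cone k u (cone k v x)) = τ u v * c (cone k v x) := by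
  suffices h : cupOne τ c ∘ₗ cone k u ∘ₗ cone k v = τ u v • (c ∘ₗ cone k v) from
    LinearMap.congr_fun h x
  ext l
  simp [cupOne_cons]

lemma cupZero_boundary (hc : ∀ x, c (boundary k x) = 0) (φ : V → k) (x : Chain k V) :
    cupZero φ c (boundary k x) = cupOne (fun u v => φ v - φ u) c x := by
  suffices h : cupZero φ c ∘ₗ boundary k = cupOne (fun u v => φ v - φ u) c from
    LinearMap.congr_fun h x
  ext l
  simp only [LinearMap.comp_apply, lsingle_apply]
  match l with
  | [] => simp [cupOne_nil]
  | [u] => simp [cupOne_singleton, boundary_single, listBoundary, cupZero_nil]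
  | u :: v :: l =>
    have h := hc (cone k u (single (v :: l) 1))
    rw [boundary_cone, map_sub, sub_eq_zero] at h
    rw [← cone_single, boundary_cone, map_sub, cupZero_cone, cone_single, cupZero_cons, cupOne_cons,
      ← h]
    ring

lemma cupOne_boundary (hc : ∀ x, c (boundary k x) = 0) (τ : V → V → k) (u v w : V) (l : List V) :
    cupOne τ c (boundary k (single (u :: v :: w :: l) 1)) =
      (τ v w - τ u w + τ u v) * c (single (w :: l) 1) := by
  have h := hc (cone k v (cone k w (single l 1)))
  have e : single (u :: v :: w :: l) (1 : k) = cone k u (cone k v (cone k w (single l 1))) := by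
    simp
  simp only [boundary_cone, map_sub] at h
  rw [e]
  simp only [boundary_cone, map_sub, cupOne_cone_cone]
  simp only [cone_single] at h ⊢
  linear_combination (-τ u v) * h

lemma cupOne_boundary_short (τ : V → V → k) {l : List V} (hl : l.length ≤ 2) :
    cupOne τ c (boundary k (single l 1)) = 0 := by
  match l with
  | [] => simp
  | [u] => simp [boundary_single, listBoundary, cupOne_nil]
  | [u, v] => simp [boundary_single, listBoundary, cupOne_singleton]
  | _ :: _ :: _ :: _ => simp at hl

/-- The sequences of points of `K`. -/
def listsIn (K : Set V) : Set (List V) := {l | ∀ v ∈ l, v ∈ K}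

lemma boundary_mem_supported_listsIn {l : List V} (hl : l ∈ listsIn K) :
    boundary k (single l 1) ∈ supported k k (listsIn K) := by
  rw [boundary_single, one_smul]
  have h := listBoundary_mem_supported (k := k) l
  exact supported_mono (by rintro _ hl' v hv; exact hl v (hl'.2 hv)) h

lemma cupZero_pushforward {T : V → V}
    (hT : ∀ l ∈ listsIn K, c (single (l.map T) 1) = c (single l 1)) (φ : V → k)
    {x : Chain k V} (hx : x ∈ supported k k (listsIn K)) :
    cupZero φ c (pushforward k T x) = cupZero (fun v => φ (T v)) c x := by
  refine linearMap_eq_of_mem_supported (f := cupZero φ c ∘ₗ pushforward k T) (fun l hl => ?_) hx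
  rw [LinearMap.comp_apply, pushforward_single]
  cases l with
  | nil => simp [cupZero_nil]
  | cons u l =>
    rw [List.map_cons, cupZero_cons, cupZero_cons, ← List.map_cons, hT _ hl]

lemma cupOne_pushforward {T : V → V}
    (hT : ∀ l ∈ listsIn K, c (single (l.map T) 1) = c (single l 1)) (τ : V → V → k)
    {x : Chain k V} (hx : x ∈ supported k k (listsIn K)) :
    cupOne τ c (pushforward k T x) = cupOne (fun u v => τ (T u) (T v)) c x := by
  refine linearMap_eq_of_mem_supported (f := cupOne τ c ∘ₗ pushforward k T) (fun l hl => ?_) hx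
  rw [LinearMap.comp_apply, pushforward_single]
  match l with
  | [] => simp [cupOne_nil]
  | [u] => simp [cupOne_singleton]
  | u :: v :: l =>
    rw [List.map_cons, List.map_cons, cupOne_cons, cupOne_cons, ← List.map_cons,
      hT _ fun w hw => hl w (List.mem_cons_of_mem _ hw)]

lemma cupOne_congr {τ τ' : V → V → k} (h : ∀ u ∈ K, ∀ v ∈ K, τ u v = τ' u v)
    {x : Chain k V} (hx : x ∈ supported k k (listsIn K)) : cupOne τ c x = cupOne τ' c x := by
  refine linearMap_eq_of_mem_supported (fun l hl => ?_) hx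
  match l with
  | [] => simp [cupOne_nil]
  | [u] => simp [cupOne_singleton]
  | u :: v :: l =>
    rw [cupOne_cons, cupOne_cons, h u (hl u (by simp)) v (hl v (by simp))]

lemma cupOne_sub (τ τ' : V → V → k) (x : Chain k V) :
    cupOne (fun u v => τ u v - τ' u v) c x = cupOne τ c x - cupOne τ' c x := by
  suffices h : cupOne (fun u v => τ u v - τ' u v) c = cupOne τ c - cupOne τ' c from
    LinearMap.congr_fun h x
  ext l
  simp only [LinearMap.comp_apply, LinearMap.sub_apply, lsingle_apply]
  match l with
  | [] => simp [cupOne_nil]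
  | [u] => simp [cupOne_singleton]
  | u :: v :: l => simp only [cupOne_cons]; ring

lemma sum_mul_cupZero {ι : Type*} (s : Finset ι) (a : ι → k) (φ : ι → V → k) (C : k)
    (h : ∀ v ∈ K, ∑ i ∈ s, a i * φ i v = C) {x : Chain k V}
    (hx : x ∈ supported k k (listsIn K ∩ {l | l ≠ []})) :
    ∑ i ∈ s, a i * cupZero (φ i) c x = C * c x := by
  have := linearMap_eq_of_mem_supported (f := ∑ i ∈ s, a i • cupZero (φ i) c) (g := C • c)
    (fun l hl => ?_) hx
  · simpa using this
  · match l with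
    | [] => exact absurd rfl hl.2
    | u :: l =>
      simp only [LinearMap.sum_apply, LinearMap.smul_apply, cupZero_cons, smul_eq_mul,
        ← h u (hl.1 u (by simp)), Finset.sum_mul, mul_assoc]

end Cochains

section PathSystems

open Finsupp

variable {k : Type*} [Field k] {V G : Type*}

/-- Cocycles which are invariant on the sequences of points of `K`. -/
structure IsInvariantCocycle (T : G → V → V) (K : Set V) (c : Chain k V →ₗ[k] k) : Prop where
  boundary_eq_zero : ∀ x, c (boundary k x) = 0
  map_eq : ∀ g, ∀ l ∈ listsIn K, c (single (l.map (T g)) 1) = c (single l 1)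

variable {T : G → V → V} {K : Set V} {c : Chain k V →ₗ[k] k}

lemma exists_isInvariantCocycle (T : G → V → V) (K : Set V) :
    ∃ c : Chain k V →ₗ[k] k, IsInvariantCocycle T K c ∧
      ∀ x, boundary k x = single [] 1 → c x = 1 := by
  classical
  let ε : Chain k V →ₗ[k] k := linearCombination k fun l => if l = [] then 1 else 0
  refine ⟨ε ∘ₗ boundary k, ⟨fun x => by simp, fun g l _ => ?_⟩, fun x hx => by simp [hx, ε]⟩
  have h : ε ∘ₗ pushforward k (T g) = ε := by
    ext l
    simp [ε]
  rw [LinearMap.comp_apply, LinearMap.comp_apply, ← pushforward_single, ← pushforward_boundary,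
    ← LinearMap.comp_apply, h]

lemma IsInvariantCocycle.cupOne_boundary (hc : IsInvariantCocycle T K c) {τ : V → V → k}
    {κ : G → V → k}
    (hτ : ∀ g, ∀ u ∈ K, ∀ v ∈ K, τ (T g u) (T g v) = τ u v - (κ g v - κ g u)) :
    IsInvariantCocycle T K (cupOne τ c ∘ₗ boundary k) := by
  refine ⟨fun x => by simp, fun g l hl => ?_⟩
  have hl' := boundary_mem_supported_listsIn (k := k) hl
  rw [LinearMap.comp_apply, LinearMap.comp_apply, ← pushforward_single, ← pushforward_boundary,
    cupOne_pushforward (hc.map_eq g) _ hl', cupOne_congr (hτ g) hl', cupOne_sub,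
    ← TopologicalTverberg.cupZero_boundary hc.boundary_eq_zero, boundary_boundary, map_zero,
    sub_zero]

variable [AddCommGroup G] [Fintype G]

/-- Chains `A n x` with the boundary relations, symmetry and support of path chains. -/
structure IsPathSystem (T : G → V → V) (K : Set V) (f : ℕ → G → k) (N : ℕ)
    (A : ℕ → G → Chain k V) : Prop where
  boundary_zero : ∀ x, boundary k (A 0 x) = single [] 1
  boundary_succ : ∀ n x, boundary k (A (n + 1) x) = ∑ y, f (n + 1) (y - x) • A n y
  pushforward_eq : ∀ n g x, pushforward k (T g) (A n x) = A n (x + g)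
  mem_supported : ∀ n ≤ N, ∀ x, A n x ∈ supported k k (listsIn K ∩ {l | l ≠ []})

variable {f : ℕ → G → k} {N : ℕ} {A : ℕ → G → Chain k V}

lemma IsPathSystem.mem_supported' (hA : IsPathSystem T K f N A) {n : ℕ} (hn : n ≤ N) (x : G) :
    A n x ∈ supported k k (listsIn K) :=
  supported_mono Set.inter_subset_left (hA.mem_supported n hn x)

lemma IsPathSystem.cupZero_boundary (hA : IsPathSystem T K f N A) (hc : IsInvariantCocycle T K c)
    (φ : V → k) {n : ℕ} (hn : n ≤ N) {C : k} (hC : ∀ v ∈ K, ∑ g, f (n + 1) g * φ (T g v) = C) :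
    cupZero φ c (boundary k (A (n + 1) 0)) = C * c (A n 0) := by
  rw [hA.boundary_succ, map_sum, ← sum_mul_cupZero _ _ _ C hC (hA.mem_supported n hn 0)]
  refine Finset.sum_congr rfl fun y _ => ?_
  rw [map_smul, sub_zero, smul_eq_mul, ← cupZero_pushforward (hc.map_eq y) φ
    (hA.mem_supported' hn 0), hA.pushforward_eq, zero_add]

lemma IsPathSystem.cupOne_boundary (hA : IsPathSystem T K f N A) (hc : IsInvariantCocycle T K c)
    {τ : V → V → k} {κ : G → V → k}
    (hτ : ∀ g, ∀ u ∈ K, ∀ v ∈ K, τ (T g u) (T g v) = τ u v - (κ g v - κ g u))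
    {n : ℕ} (hn : n + 1 ≤ N) (hf : ∑ g, f (n + 2) g = 0) {C : G → k}
    (hC : ∀ g, ∀ v ∈ K, ∑ h, f (n + 1) h * κ g (T h v) = C g) :
    cupOne τ c (boundary k (A (n + 2) 0)) = -(∑ g, f (n + 2) g * C g) * c (A n 0) := by
  have h : ∀ y, cupOne τ c (A (n + 1) y) = cupOne τ c (A (n + 1) 0) - C y * c (A n 0) := fun y => by
    rw [← hA.cupZero_boundary hc (κ y) (by omega) (hC y),
      TopologicalTverberg.cupZero_boundary hc.boundary_eq_zero, ← cupOne_sub,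
      ← cupOne_congr (hτ y) (hA.mem_supported' hn 0),
      ← cupOne_pushforward (hc.map_eq y) _ (hA.mem_supported' hn 0), hA.pushforward_eq, zero_add]
  have h' : ∀ y, cupOne τ c (f (n + 2) (y - 0) • A (n + 1) y) =
      f (n + 2) y * cupOne τ c (A (n + 1) 0) - f (n + 2) y * C y * c (A n 0) := fun y => by
    rw [map_smul, sub_zero, h y, smul_eq_mul]
    ring
  rw [hA.boundary_succ, map_sum, Finset.sum_congr rfl fun y _ => h' y, Finset.sum_sub_distrib,
    ← Finset.sum_mul, ← Finset.sum_mul, hf]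
  ring

end PathSystems

section Bockstein

open Finsupp

variable {p : ℕ} [Fact p.Prime]

/-- The defect of additivity of the centered lift from `ZMod p` to `ℤ`, divided by `p`. -/
def carry (s a : ZMod p) : ℤ := ((a + s).valMinAbs - a.valMinAbs - s.valMinAbs) / p

lemma mul_carry (s a : ZMod p) :
    p * carry s a = (a + s).valMinAbs - a.valMinAbs - s.valMinAbs :=
  Int.mul_ediv_cancel' <| (ZMod.intCast_zmod_eq_zero_iff_dvd _ p).1 <| by simp

lemma sum_carry (s : ZMod p) : ∑ a, carry s a = -s.valMinAbs := by
  have hp : (p : ℤ) ≠ 0 := by exact_mod_cast (Fact.out : p.Prime).ne_zero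
  refine mul_left_cancel₀ hp ?_
  rw [Finset.mul_sum]
  have h := Equiv.sum_comp (Equiv.addRight s) ZMod.valMinAbs
  simp only [Equiv.coe_addRight] at h
  simp only [mul_carry, Finset.sum_sub_distrib, h]
  simp

lemma valMinAbs_neg_one_add (hp : p ≠ 2) :
    (-1 : ZMod p).valMinAbs = -(1 : ZMod p).valMinAbs := by
  refine ZMod.valMinAbs_neg_of_ne_half fun h => hp ?_
  have : Fact (1 < p) := ⟨(Fact.out : p.Prime).one_lt⟩
  rw [← h, ZMod.val_one]

lemma carry_shift (s a b : ZMod p) :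
    carry (b + s - (a + s)) (a + s) = carry (b - a) a + (carry s b - carry s a) := by
  have hp : (p : ℤ) ≠ 0 := by exact_mod_cast (Fact.out : p.Prime).ne_zero
  refine mul_left_cancel₀ hp ?_
  rw [add_sub_add_right_eq_sub, mul_add, mul_sub, mul_carry, mul_carry, mul_carry, mul_carry,
    add_sub_cancel, show a + s + (b - a) = b + s by ring]
  ring

lemma carry_cocycle_eq_zero (hp : p ≠ 2) {j a b c : ZMod p} (ha : a = j ∨ a = j + 1)
    (hb : b = j ∨ b = j + 1) (hc : c = j ∨ c = j + 1) :
    carry (c - b) b - carry (c - a) a + carry (b - a) a = 0 := by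
  have hp' : (p : ℤ) ≠ 0 := by exact_mod_cast (Fact.out : p.Prime).ne_zero
  have h := valMinAbs_neg_one_add hp
  refine mul_left_cancel₀ hp' ?_
  simp only [mul_add, mul_sub, mul_carry, add_sub_cancel]
  rcases ha with rfl | rfl <;> rcases hb with rfl | rfl <;> rcases hc with rfl | rfl <;>
    simp [h]
  ring

end Bockstein

section Blocks

open Finsupp

variable {p : ℕ} [Fact p.Prime] {k : Type*} [Field k] [Algebra (ZMod p) k] {V G : Type*}

/-- The labels of the points of a sequence are not contained in `{j}`, nor, if `p` is odd, in
`{j, j + 1}`, for any `j`. -/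
def IsSpread (label : V → ZMod p) (l : List V) : Prop :=
  ¬ ∃ j, ∀ v ∈ l, label v = j ∨ p ≠ 2 ∧ label v = j + 1

lemma IsSpread.mono {label : V → ZMod p} {l l' : List V} (h : IsSpread label l) (hl : l ⊆ l') :
    IsSpread label l' :=
  fun ⟨j, hj⟩ => h ⟨j, fun v hv => hj v (hl hv)⟩

lemma algebraMap_valMinAbs (a : ZMod p) : ((a.valMinAbs : ℤ) : k) = algebraMap (ZMod p) k a := by
  rw [← map_intCast (algebraMap (ZMod p) k), ZMod.coe_valMinAbs]

/-- The 2-periodic sequence of weights `f₀, f₁, f₀, f₁, …`. -/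
def weights (f₀ f₁ : G → k) (n : ℕ) : G → k := if Even n then f₀ else f₁

/-- The weights `f₀` and `f₁` detect the map `s`. -/
def Detects (f₀ f₁ : G → k) [Fintype G] (s : G → ZMod p) : Prop :=
  ∑ g, f₀ g * algebraMap (ZMod p) k (s g) ≠ 0 ∧ (p = 2 → f₁ = f₀) ∧
    ∃ c ≠ 0, ∀ h : ZMod p → k, ∑ g, f₁ g * h (s g) = c * ∑ a, h a

variable {T : G → V → V} {K : Set V} {N : ℕ} {A : ℕ → G → Chain k V} {c : Chain k V →ₗ[k] k}
  {label : V → ZMod p} {s : G → ZMod p} [AddCommGroup G] [Fintype G] {f₀ f₁ : G → k}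

lemma IsInvariantCocycle.exists_of_eq_two (hp : p = 2) (hc : IsInvariantCocycle T K c)
    (hs : ∀ g, ∀ v ∈ K, label (T g v) = label v + s g) (hf₀ : ∑ g, f₀ g = 0)
    (hd : Detects f₀ f₁ s) :
    ∃ c' : Chain k V →ₗ[k] k, IsInvariantCocycle T K c' ∧
      (∀ A, IsPathSystem T K (weights f₀ f₁) N A → ∀ n, n ≤ N → c (A n 0) ≠ 0 →
        c' (A (n + 1) 0) ≠ 0) ∧
      ∀ l, c' (single l 1) ≠ 0 → IsSpread label l ∧ ∃ l' ⊆ l, c (single l' 1) ≠ 0 := by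
  obtain ⟨hμ, hf₁, -⟩ := hd
  set φ : V → k := fun v => algebraMap (ZMod p) k (label v) with hφ
  have hval : ∀ x, (cupZero φ c ∘ₗ boundary k) x = cupOne (fun u v => φ v - φ u) c x :=
    fun x => cupZero_boundary hc.boundary_eq_zero φ x
  refine ⟨cupZero φ c ∘ₗ boundary k, ⟨fun x => by simp, fun g l hl => ?_⟩, fun A hA n hn h0 => ?_,
    fun l hl => ?_⟩
  · have hl' : single l (1 : k) ∈ supported k k (listsIn K) := single_mem_supported _ _ hl
    rw [hval, hval, ← pushforward_single, cupOne_pushforward (hc.map_eq g) _ hl']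
    refine cupOne_congr (fun u hu v hv => ?_) hl'
    simp [hφ, hs g u hu, hs g v hv]
  · have hf : weights f₀ f₁ (n + 1) = f₀ := by simp [weights, hf₁ hp]
    rw [LinearMap.comp_apply, hA.cupZero_boundary hc φ hn
      (C := ∑ g, f₀ g * algebraMap (ZMod p) k (s g))]
    · exact mul_ne_zero hμ h0
    · intro v hv
      simp only [hf, hφ, hs _ v hv, map_add, mul_add, Finset.sum_add_distrib, ← Finset.sum_mul, hf₀,
        zero_mul, zero_add]
  · rw [hval] at hl
    match l with
    | [] => simp [cupOne_nil] at hl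
    | [u] => simp [cupOne_singleton] at hl
    | u :: v :: l =>
      rw [cupOne_cons] at hl
      refine ⟨?_, v :: l, by simp, right_ne_zero_of_mul hl⟩
      rintro ⟨j, hj⟩
      simp only [hp, ne_eq, not_true_eq_false, false_and, or_false] at hj
      exact left_ne_zero_of_mul hl (by simp [hφ, hj u, hj v])

lemma IsInvariantCocycle.exists_of_ne_two (hp : p ≠ 2) (hc : IsInvariantCocycle T K c)
    (hs : ∀ g, ∀ v ∈ K, label (T g v) = label v + s g) (hf₀ : ∑ g, f₀ g = 0)
    (hd : Detects f₀ f₁ s) :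
    ∃ c' : Chain k V →ₗ[k] k, IsInvariantCocycle T K c' ∧
      (∀ A, IsPathSystem T K (weights f₀ f₁) N A → ∀ n, Even n → n + 1 ≤ N → c (A n 0) ≠ 0 →
        c' (A (n + 2) 0) ≠ 0) ∧
      ∀ l, c' (single l 1) ≠ 0 → IsSpread label l ∧ ∃ l' ⊆ l, c (single l' 1) ≠ 0 := by
  obtain ⟨hμ, -, c₁, hc₁, hsum⟩ := hd
  set τ : V → V → k := fun u v => (carry (label v - label u) (label u) : k) with hτ
  set κ : G → V → k := fun g v => -(carry (s g) (label v) : k) with hκ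
  have hτκ : ∀ g, ∀ u ∈ K, ∀ v ∈ K, τ (T g u) (T g v) = τ u v - (κ g v - κ g u) := by
    intro g u hu v hv
    simp only [hτ, hκ, hs g u hu, hs g v hv, carry_shift]
    push_cast
    ring
  refine ⟨cupOne τ c ∘ₗ boundary k, hc.cupOne_boundary hτκ, fun A hA n he hn h0 => ?_,
    fun l hl => ?_⟩
  · have hf : weights f₀ f₁ (n + 1) = f₁ := by
      simp [weights, Nat.even_add_one, he]
    have hf' : weights f₀ f₁ (n + 2) = f₀ := by
      simp [weights, Nat.even_add, he]
    rw [LinearMap.comp_apply, hA.cupOne_boundary hc hτκ hn (by rwa [hf'])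
      (C := fun g => c₁ * algebraMap (ZMod p) k (s g)), hf']
    · refine mul_ne_zero (neg_ne_zero.2 ?_) h0
      simp only [mul_left_comm _ c₁, ← Finset.mul_sum]
      exact mul_ne_zero hc₁ hμ
    · intro g v hv
      have h := hsum fun a => -(carry (s g) (label v + a) : k)
      have h' := Equiv.sum_comp (Equiv.addLeft (label v)) (carry (s g))
      simp only [Equiv.coe_addLeft, sum_carry] at h'
      simp only [hf, hκ, hs _ v hv, h, Finset.sum_neg_distrib, ← Int.cast_sum, h', Int.cast_neg,
        neg_neg, algebraMap_valMinAbs]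
  · rw [LinearMap.comp_apply] at hl
    match l with
    | [] => exact absurd (cupOne_boundary_short τ (by simp)) hl
    | [u] => exact absurd (cupOne_boundary_short τ (by simp)) hl
    | [u, v] => exact absurd (cupOne_boundary_short τ (by simp)) hl
    | u :: v :: w :: l =>
      rw [TopologicalTverberg.cupOne_boundary hc.boundary_eq_zero] at hl
      refine ⟨?_, w :: l, by simp, right_ne_zero_of_mul hl⟩
      rintro ⟨j, hj⟩
      refine left_ne_zero_of_mul hl ?_
      have hj' : ∀ x ∈ u :: v :: w :: l, label x = j ∨ label x = j + 1 := fun x hx =>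
        (hj x hx).imp id And.right
      have := carry_cocycle_eq_zero hp (hj' u (by simp)) (hj' v (by simp)) (hj' w (by simp))
      simp only [hτ]
      rw [← Int.cast_sub, ← Int.cast_add, this, Int.cast_zero]

/-- Invariant cocycles which are supported on the sequences spread with respect to each of the
given labellings, and which do not vanish on path systems. -/
lemma exists_isInvariantCocycle_of_labels (hf₀ : ∑ g, f₀ g = 0)
    (bs : List ((V → ZMod p) × (G → ZMod p)))
    (hs : ∀ b ∈ bs, ∀ g, ∀ v ∈ K, b.1 (T g v) = b.1 v + b.2 g) (hd : ∀ b ∈ bs, Detects f₀ f₁ b.2)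
    (hN : (if p = 2 then 1 else 2) * bs.length ≤ N) :
    ∃ c : Chain k V →ₗ[k] k, IsInvariantCocycle T K c ∧
      (∀ A, IsPathSystem T K (weights f₀ f₁) N A →
        c (A ((if p = 2 then 1 else 2) * bs.length) 0) ≠ 0) ∧
      ∀ l, c (single l 1) ≠ 0 → ∀ b ∈ bs, IsSpread b.1 l := by
  induction bs with
  | nil =>
    obtain ⟨c, hc, h⟩ := exists_isInvariantCocycle (k := k) T K
    refine ⟨c, hc, fun A hA => ?_, by simp⟩
    rw [List.length_nil, mul_zero, h _ (hA.boundary_zero 0)]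
    exact one_ne_zero
  | cons b bs ih =>
    rw [List.length_cons, mul_add, mul_one] at hN ⊢
    simp only [List.mem_cons, forall_eq_or_imp] at hs hd
    obtain ⟨c, hc, hcA, hcl⟩ := ih hs.2 hd.2 (by omega)
    obtain ⟨c', hc', hcA', hcl'⟩ : ∃ c' : Chain k V →ₗ[k] k, IsInvariantCocycle T K c' ∧
        (∀ A, IsPathSystem T K (weights f₀ f₁) N A →
          c' (A ((if p = 2 then 1 else 2) * bs.length + if p = 2 then 1 else 2) 0) ≠ 0) ∧
        ∀ l, c' (single l 1) ≠ 0 → IsSpread b.1 l ∧ ∃ l' ⊆ l, c (single l' 1) ≠ 0 := by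
      by_cases hp : p = 2
      · obtain ⟨c', hc', h, h'⟩ := hc.exists_of_eq_two (N := N) hp hs.1 hf₀ hd.1
        exact ⟨c', hc', fun A hA => by
          simpa [hp] using h A hA _ (by simp [hp] at hN; omega) (by simpa [hp] using hcA A hA), h'⟩
      · obtain ⟨c', hc', h, h'⟩ := hc.exists_of_ne_two (N := N) hp hs.1 hf₀ hd.1
        exact ⟨c', hc', fun A hA => by
          simpa [hp] using h A hA (2 * bs.length) (by simp) (by simp [hp] at hN; omega)
            (by simpa [hp] using hcA A hA), h'⟩
    refine ⟨c', hc', hcA', fun l hl => ?_⟩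
    obtain ⟨hb, l', hl', hcl''⟩ := hcl' l hl
    simp only [List.mem_cons, forall_eq_or_imp]
    exact ⟨hb, fun b' hb' => (hcl l' hcl'' b' hb').mono hl'⟩

end Blocks

section Weights

open AddMonoidAlgebra

variable {k : Type*} [Field k] {G : Type*} [Fintype G]

/-- Integration of a function against an element of the group algebra. -/
noncomputable def integral (φ : G → k) : AddMonoidAlgebra k G →ₗ[k] k where
  toFun U := ∑ g, U.coeff g * φ g
  map_add' U W := by simp [add_mul, Finset.sum_add_distrib]
  map_smul' a U := by simp [mul_assoc, Finset.mul_sum]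

lemma integral_apply (φ : G → k) (U : AddMonoidAlgebra k G) :
    integral φ U = ∑ g, U.coeff g * φ g := rfl

lemma integral_single (φ : G → k) (g : G) (a : k) : integral φ (single g a) = a * φ g := by
  classical
  simp [integral_apply, Finsupp.single_apply]

variable [AddCommGroup G]

lemma integral_one (φ : G → k) : integral φ 1 = φ 0 := by
  rw [one_def, integral_single, one_mul]

lemma coeff_mul_eq_sum (U W : AddMonoidAlgebra k G) (z : G) :
    (U * W).coeff z = ∑ y, U.coeff y * W.coeff (z - y) := by
  classical
  rw [AddMonoidAlgebra.coeff_mul, Finsupp.sum_fintype _ _ (by simp)]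
  refine Finset.sum_congr rfl fun y _ => ?_
  rw [Finsupp.sum_fintype _ _ (by simp)]
  simp only [← eq_sub_iff_add_eq']
  simp

lemma integral_mapDomain {H : Type*} [AddCommGroup H] [Fintype H] (s : G →+ H) (φ : H → k)
    (U : AddMonoidAlgebra k G) :
    integral φ (mapDomainAlgHom k k s U) = integral (fun g => φ (s g)) U := by
  suffices h : integral φ ∘ₗ (mapDomainAlgHom k k s).toLinearMap = integral (fun g => φ (s g)) from
    LinearMap.congr_fun h U
  ext g
  simp [integral_single]

variable {p : ℕ} [Fact p.Prime]

instance charP_addMonoidAlgebra [CharP k p] : CharP (AddMonoidAlgebra k G) p :=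
  charP_of_injective_algebraMap (algebraMap k (AddMonoidAlgebra k G)).injective p

lemma sub_one_pow_pred [CharP k p] {R : Type*} [CommRing R] [Algebra k R] (x : R) :
    (x - 1) ^ (p - 1) = ∑ i ∈ Finset.range p, x ^ i := by
  open Polynomial in
  have h : ((X : k[X]) - 1) ^ (p - 1) = ∑ i ∈ Finset.range p, X ^ i := by
    have h1 : (X : k[X]) - 1 ≠ 0 := by simpa using X_sub_C_ne_zero (1 : k)
    refine mul_left_cancel₀ h1 ?_
    rw [mul_geom_sum, ← pow_succ', Nat.sub_add_cancel (Fact.out : p.Prime).one_le, sub_pow_char,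
      one_pow]
  simpa using congrArg (Polynomial.aeval x) h

variable (k) in
/-- The norm element of the group algebra of `ZMod p`. -/
noncomputable def normElement (p : ℕ) : AddMonoidAlgebra k (ZMod p) :=
  ∑ i ∈ Finset.range p, single (1 : ZMod p) (1 : k) ^ i

lemma single_one_mul_normElement :
    single (1 : ZMod p) (1 : k) * normElement k p = normElement k p := by
  have h := mul_geom_sum (single (1 : ZMod p) (1 : k)) p
  rw [single_pow, nsmul_eq_mul, CharP.cast_eq_zero, zero_mul, one_pow, ← one_def, sub_self,
    sub_mul, one_mul, sub_eq_zero] at h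
  exact h

lemma single_one_pow_mul_normElement (i : ℕ) :
    single (1 : ZMod p) (1 : k) ^ i * normElement k p = normElement k p := by
  induction i with
  | zero => simp
  | succ i ih => rw [pow_succ', mul_assoc, ih, single_one_mul_normElement]

lemma integral_normElement (h : ZMod p → k) : integral h (normElement k p) = ∑ a, h a := by
  rw [normElement, map_sum]
  simp only [single_pow, one_pow, integral_single, one_mul, nsmul_eq_mul, mul_one]
  refine Finset.sum_nbij' (fun i => (i : ZMod p)) ZMod.val ?_ ?_ ?_ ?_ ?_
  · simp
  · simp [ZMod.val_lt]
  · exact fun i hi => ZMod.val_cast_of_lt (Finset.mem_range.1 hi)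
  · simp
  · simp

lemma exists_single_sub_one (a : ZMod p) : ∃ v : AddMonoidAlgebra k (ZMod p),
    single a 1 - 1 = (single 1 1 - 1) * v ∧
      v * normElement k p = (a.val : k) • normElement k p := by
  refine ⟨∑ i ∈ Finset.range a.val, single 1 1 ^ i, ?_, ?_⟩
  · rw [mul_geom_sum, single_pow]
    simp
  · rw [Finset.sum_mul, Finset.sum_congr rfl fun i _ => single_one_pow_mul_normElement i,
      Finset.sum_const, Finset.card_range, Nat.cast_smul_eq_nsmul]

lemma sum_single_sub_one_pow [CharP k p] {ι : Type*} (t : Finset ι) (w : ι → k) (a : ι → ZMod p) :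
    (∑ i ∈ t, w i • (single (a i) (1 : k) - 1)) ^ (p - 1) =
      (∑ i ∈ t, w i * ((a i).val : k)) ^ (p - 1) • normElement k p := by
  choose v hv hv' using exists_single_sub_one (k := k) (p := p)
  have h1 : ∑ i ∈ t, w i • (single (a i) (1 : k) - 1) =
      (single 1 1 - 1) * ∑ i ∈ t, w i • v (a i) := by
    rw [Finset.mul_sum]
    exact Finset.sum_congr rfl fun i _ => by rw [hv, mul_smul_comm]
  have h2 : (∑ i ∈ t, w i • v (a i)) * normElement k p =
      (∑ i ∈ t, w i * ((a i).val : k)) • normElement k p := by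
    rw [Finset.sum_mul, Finset.sum_smul]
    exact Finset.sum_congr rfl fun i _ => by rw [smul_mul_assoc, hv', smul_smul]
  have h3 : ∀ n : ℕ, (∑ i ∈ t, w i • v (a i)) ^ n * normElement k p =
      (∑ i ∈ t, w i * ((a i).val : k)) ^ n • normElement k p := fun n => by
    induction n with
    | zero => simp
    | succ n ih => rw [pow_succ, mul_assoc, h2, mul_smul_comm, ih, smul_smul, pow_succ']
  rw [h1, mul_pow, sub_one_pow_pred (k := k), mul_comm, ← h3]
  rfl

end Weights

section FiniteField

open AddMonoidAlgebra

variable {p : ℕ} [Fact p.Prime] (F : Type*) [Field F] [Fintype F] [Algebra (ZMod p) F]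

lemma exists_sum_inv_mul_ne_zero :
    ∃ s : F →ₗ[ZMod p] ZMod p, ∑ x : F, x⁻¹ * algebraMap (ZMod p) F (s x) ≠ 0 := by
  classical
  by_contra! h
  let b := Module.finBasis (ZMod p) F
  have h1 : ∑ x : F, x⁻¹ * x = 0 := by
    calc ∑ x : F, x⁻¹ * x
        = ∑ x : F, ∑ i, b i * (x⁻¹ * algebraMap (ZMod p) F (b.coord i x)) := by
          refine Finset.sum_congr rfl fun x _ => ?_
          conv_lhs => rw [← b.sum_repr x, Finset.mul_sum]
          refine Finset.sum_congr rfl fun i _ => ?_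
          rw [b.sum_repr, Algebra.smul_def, Module.Basis.coord_apply]
          ring
      _ = 0 := by
          rw [Finset.sum_comm]
          simp only [← Finset.mul_sum, h, mul_zero, Finset.sum_const_zero]
  have h2 : ∀ x : F, x⁻¹ * x = 1 - if x = 0 then 1 else 0 := fun x => by
    by_cases hx : x = 0 <;> simp [hx]
  simp [h2] at h1

/-- There are weights on a finite field which convolve to zero and detect all the nonzero
multiples of an additive character. -/
lemma exists_weights :
    ∃ (f₀ f₁ : F → F) (s : F →+ ZMod p), ∑ x, f₀ x = 0 ∧ ∑ x, f₁ x = 0 ∧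
      (∀ z, ∑ y, f₀ y * f₁ (z - y) = 0) ∧ (∀ z, ∑ y, f₁ y * f₀ (z - y) = 0) ∧
      ∀ a ≠ 0, Detects f₀ f₁ fun x => s (a * x) := by
  obtain ⟨s, hs⟩ := exists_sum_inv_mul_ne_zero (p := p) F
  have : CharP F p := charP_of_injective_algebraMap (algebraMap (ZMod p) F).injective p
  have hp : p - 1 + 1 = p := Nat.sub_add_cancel (Fact.out : p.Prime).one_le
  set U : AddMonoidAlgebra F F := ∑ x : F, x⁻¹ • (single x 1 - 1) with hU
  have hUp : U ^ p = 0 := by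
    rw [hU, sum_pow_char]
    refine Finset.sum_eq_zero fun x _ => ?_
    rw [smul_pow, sub_pow_char, single_pow]
    simp [one_def]
  have hint : ∀ φ : F → F, integral φ U = ∑ x, x⁻¹ * (φ x - φ 0) := fun φ => by
    rw [hU, map_sum]
    simp [integral_single, integral_one]
  have hd : ∀ a ≠ 0, Detects (p := p) U.coeff (U ^ (p - 1)).coeff fun x => s (a * x) := by
    intro a ha
    have hμ : ∑ x, x⁻¹ * algebraMap (ZMod p) F (s (a * x)) ≠ 0 := by
      have h := Equiv.sum_comp (Equiv.mulLeft₀ a ha)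
        fun y => a * (y⁻¹ * algebraMap (ZMod p) F (s y))
      rw [← Finset.mul_sum Finset.univ (fun y : F => y⁻¹ * algebraMap (ZMod p) F (s y))] at h
      convert mul_ne_zero ha hs using 1
      rw [← h]
      refine Finset.sum_congr rfl fun x _ => ?_
      rw [Equiv.mulLeft₀_apply, mul_inv]
      field_simp
    refine ⟨?_, ?_, ?_⟩
    · rw [← integral_apply, hint]
      simpa using hμ
    · rintro rfl
      simp
    · refine ⟨_, pow_ne_zero (p - 1) hμ, fun h => ?_⟩
      rw [← integral_apply]
      have := integral_mapDomain (s.toAddMonoidHom.comp (AddMonoidHom.mulLeft a)) h (U ^ (p - 1))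
      simp only [AddMonoidHom.comp_apply, AddMonoidHom.coe_mulLeft, LinearMap.toAddMonoidHom_coe]
        at this
      rw [← this, map_pow, hU, map_sum]
      simp only [map_smul, map_sub, map_one]
      have hval : ∀ z : ZMod p, (z.val : F) = algebraMap (ZMod p) F z := fun z => by
        rw [← map_natCast (algebraMap (ZMod p) F), ZMod.natCast_zmod_val]
      have h' := sum_single_sub_one_pow Finset.univ (fun x : F => x⁻¹) fun x => s (a * x)
      simp only [hval] at h'
      rw [← integral_normElement h, ← smul_eq_mul, ← map_smul, ← h']
      congr 2
      refine Finset.sum_congr rfl fun x _ => ?_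
      simp
  refine ⟨U.coeff, (U ^ (p - 1)).coeff, s.toAddMonoidHom, ?_, ?_, fun z => ?_, fun z => ?_, hd⟩
  · simpa [integral_apply] using hint 1
  · obtain ⟨-, -, c, -, h⟩ := hd 1 one_ne_zero
    simpa using h 1
  · rw [← coeff_mul_eq_sum, ← pow_succ', hp, hUp]
    rfl
  · rw [← coeff_mul_eq_sum, ← pow_succ, hp, hUp]
    rfl

end FiniteField

section Limit

open Finsupp Filter Topology

variable {k : Type*} [Field k] {E G : Type*} [NormedAddCommGroup E] [NormedSpace ℝ E]
  [AddCommGroup G] [Fintype G] {𝒞 : Set (Set E)} {T : G → E →ₗ[ℝ] E} {e : ℕ → G → E}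
  {f : ℕ → G → k} {N : ℕ}

variable (e f) in
/-- The iterated barycentric subdivisions of path chains. -/
noncomputable def subdividedPathChain (j n : ℕ) (x : G) : Chain k E :=
  (subdivision k barycenter (n + 1))^[j] (pathChain e f n x)

lemma subdividedPathChain_mem_supported (h𝒞 : ∀ C ∈ 𝒞, Convex ℝ C)
    (he : ∀ c : ℕ → G, ∃ C ∈ 𝒞, ∀ i ≤ N, e i (c i) ∈ C) {D : ℝ} (hD : 0 ≤ D)
    (hdist : ∀ u ∈ ⋃₀ 𝒞, ∀ v ∈ ⋃₀ 𝒞, dist u v ≤ D) (j : ℕ) {n : ℕ} (hn : n ≤ N) (x : G) :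
    subdividedPathChain e f j n x ∈
      supported k k (fineLists 𝒞 (n + 1) ((n / (n + 1) : ℝ) ^ j * D)) := by
  have h := iterate_subdivision_mem_supported (k := k) h𝒞 hD n.succ_pos j
    (supported_mono ?_ (pathChain_mem_supported e f n x))
  · simpa [subdividedPathChain] using h
  · rintro l ⟨hl, c, hc⟩
    obtain ⟨C, hC, h⟩ := he c
    have hlC : ∀ v ∈ l, v ∈ C := fun v hv => by
      obtain ⟨i, hi, rfl⟩ := hc v hv
      exact h i (hi.trans hn)
    exact ⟨hl, ⟨C, hC, hlC⟩, fun u hu v hv => hdist u ⟨C, hC, hlC u hu⟩ v ⟨C, hC, hlC v hv⟩⟩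

lemma isPathSystem_subdividedPathChain (h𝒞 : ∀ C ∈ 𝒞, Convex ℝ C)
    (hbdd : Bornology.IsBounded (⋃₀ 𝒞)) (he : ∀ c : ℕ → G, ∃ C ∈ 𝒞, ∀ i ≤ N, e i (c i) ∈ C)
    (hT : ∀ g i x, T g (e i x) = e i (x + g)) (hf : ∀ n, ∑ y, f n y = 0)
    (hff : ∀ n z, ∑ y, f (n + 1) y * f n (z - y) = 0) (j : ℕ) :
    IsPathSystem (fun g v => T g v) (⋃₀ 𝒞) f N (subdividedPathChain e f j) where
  boundary_zero x := by
    rw [subdividedPathChain, boundary_iterate_subdivision, boundary_pathChain_zero]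
    exact congrFun (Function.iterate_id j) _
  boundary_succ n x := by
    rw [subdividedPathChain, boundary_iterate_subdivision, boundary_pathChain_succ e f hf hff]
    simp only [subdividedPathChain, ← Module.End.pow_apply, map_sum, map_smul]
  pushforward_eq n g x := by
    rw [subdividedPathChain, pushforward_iterate_subdivision k barycenter _
      (barycenter_map (T g)), pushforward_pathChain e f (hT g)]
    rfl
  mem_supported n hn x := by
    refine supported_mono ?_ (subdividedPathChain_mem_supported h𝒞 he Metric.diam_nonneg
      (fun u hu v hv => Metric.dist_le_diam_of_mem hbdd hu hv) j hn x)
    rintro l ⟨hl, ⟨C, hC, hlC⟩, -⟩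
    exact ⟨fun v hv => ⟨C, hC, hlC v hv⟩, by rintro rfl; simp at hl⟩

variable {p : ℕ} [Fact p.Prime] [Algebra (ZMod p) k] {f₀ f₁ : G → k}

/-- A point of the complex near which none of the given equivariant labellings takes a single
value or, if `p` is odd, two successive values. -/
lemma exists_forall_not_eventually_label (h𝒞 : ∀ C ∈ 𝒞, Convex ℝ C) (hK : IsCompact (⋃₀ 𝒞))
    (he : ∀ c : ℕ → G, ∃ C ∈ 𝒞, ∀ i ≤ N, e i (c i) ∈ C)
    (hT : ∀ g i x, T g (e i x) = e i (x + g))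
    (hf₀ : ∑ x, f₀ x = 0) (hf₁ : ∑ x, f₁ x = 0) (hf₀₁ : ∀ z, ∑ y, f₀ y * f₁ (z - y) = 0)
    (hf₁₀ : ∀ z, ∑ y, f₁ y * f₀ (z - y) = 0) (bs : List ((E → ZMod p) × (G → ZMod p)))
    (hs : ∀ b ∈ bs, ∀ g, ∀ v ∈ ⋃₀ 𝒞, b.1 (T g v) = b.1 v + b.2 g)
    (hd : ∀ b ∈ bs, Detects f₀ f₁ b.2) (hN : (if p = 2 then 1 else 2) * bs.length ≤ N) :
    ∃ y ∈ ⋃₀ 𝒞, ∀ b ∈ bs, ∀ j, ¬ ∀ᶠ v in 𝓝[⋃₀ 𝒞] y, b.1 v = j ∨ p ≠ 2 ∧ b.1 v = j + 1 := by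
  obtain ⟨c, -, hcA, hcl⟩ := exists_isInvariantCocycle_of_labels (T := fun g v => T g v) hf₀ bs hs
    hd hN
  have hf : ∀ n, ∑ y, weights f₀ f₁ n y = 0 := fun n => by
    unfold weights
    split_ifs <;> assumption
  have hff : ∀ n z, ∑ y, weights f₀ f₁ (n + 1) y * weights f₀ f₁ n (z - y) = 0 := fun n z => by
    by_cases hn : Even n <;> simp [weights, Nat.even_add_one, hn, hf₀₁, hf₁₀]
  set n := (if p = 2 then 1 else 2) * bs.length
  set D := Metric.diam (⋃₀ 𝒞)
  have hlist : ∀ j : ℕ, ∃ l ∈ fineLists 𝒞 (n + 1) ((n / (n + 1) : ℝ) ^ j * D),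
      c (single l 1) ≠ 0 := fun j => by
    by_contra! h
    refine hcA _ (isPathSystem_subdividedPathChain h𝒞 hK.isBounded he hT hf hff j) ?_
    exact linearMap_eq_of_mem_supported (g := 0) (fun l hl => by simpa using h l hl)
      (subdividedPathChain_mem_supported h𝒞 he Metric.diam_nonneg
        (fun u hu v hv => Metric.dist_le_diam_of_mem hK.isBounded hu hv) j hN 0)
  choose l hl hcl' using hlist
  have hne : ∀ j, l j ≠ [] := fun j h => by simpa [h] using (hl j).1
  have hmem : ∀ j, ∀ v ∈ l j, v ∈ ⋃₀ 𝒞 := fun j v hv => by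
    obtain ⟨-, ⟨C, hC, h⟩, -⟩ := hl j
    exact ⟨C, hC, h v hv⟩
  obtain ⟨y, hy, φ, hφ, hlim⟩ := hK.tendsto_subseq fun j => hmem j _ (List.head_mem (hne j))
  refine ⟨y, hy, fun b hb i hev => ?_⟩
  obtain ⟨ε, hε, hball⟩ := Metric.mem_nhdsWithin_iff.1 hev
  have hmesh : Tendsto (fun j => (n / (n + 1) : ℝ) ^ φ j * D) atTop (𝓝 0) := by
    have h : Tendsto (fun j => (n / (n + 1) : ℝ) ^ j * D) atTop (𝓝 (0 * D)) :=
      (tendsto_pow_atTop_nhds_zero_of_lt_one (by positivity)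
        (by rw [div_lt_one (by positivity)]; linarith)).mul_const D
    rw [zero_mul] at h
    exact h.comp hφ.tendsto_atTop
  obtain ⟨j, hj₁, hj₂⟩ := ((hmesh.eventually_lt_const (half_pos hε)).and
    (Metric.tendsto_nhds.1 hlim (ε / 2) (half_pos hε))).exists
  refine hcl _ (hcl' (φ j)) b hb ⟨i, fun v hv => hball ⟨?_, hmem _ v hv⟩⟩
  have h := (hl (φ j)).2.2 v hv _ (List.head_mem (hne (φ j)))
  rw [Metric.mem_ball]
  have := dist_triangle v ((l (φ j)).head (hne (φ j))) y
  simp only [Function.comp_apply] at hj₂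
  linarith

end Limit

section Sectors

open Filter Topology

variable {p : ℕ}

/-- The index of the sector of angle `2 * π / p` containing a complex number. -/
noncomputable def sector (p : ℕ) (z : ℂ) : ZMod p := (⌊p * z.arg / (2 * Real.pi)⌋ : ℤ)

lemma eventually_sector_eq (p : ℕ) {z : ℂ} (hz : z ≠ 0) (hz' : z.im = 0) :
    ∀ᶠ w in 𝓝 z, w.im = 0 → sector p w = sector p z := by
  have h : Tendsto (fun w : ℂ => (w / z).re) (𝓝 z) (𝓝 1) := by
    have h1 : ContinuousAt (fun w : ℂ => (w / z).re) z :=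
      Complex.continuous_re.continuousAt.comp (continuousAt_id.div_const z)
    simpa [ContinuousAt, hz] using h1
  filter_upwards [h.eventually_const_lt one_pos] with w hw hw'
  have h1 : w = ((w / z).re : ℂ) * z := by
    have : (((w / z).re : ℝ) : ℂ) = w / z := by
      rw [← Complex.conj_eq_iff_re, map_div₀, Complex.conj_eq_iff_im.2 hw',
        Complex.conj_eq_iff_im.2 hz']
    rw [this, div_mul_cancel₀ _ hz]
  rw [h1, sector, Complex.arg_real_mul _ hw, sector]

variable [Fact p.Prime]

lemma sector_eq {z : ℂ} {r θ : ℝ} (hr : 0 < r) (hz : z = r * Complex.exp (θ * Complex.I)) :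
    sector p z = (⌊p * θ / (2 * Real.pi)⌋ : ℤ) := by
  have h := Complex.arg_mul_cos_add_sin_mul_I_coe_angle hr (θ : Real.Angle)
  rw [Real.Angle.cos_coe, Real.Angle.sin_coe, Complex.ofReal_cos, Complex.ofReal_sin,
    ← Complex.exp_mul_I, ← hz, Real.Angle.angle_eq_iff_two_pi_dvd_sub] at h
  obtain ⟨n, hn⟩ := h
  have h' : p * z.arg / (2 * Real.pi) = p * θ / (2 * Real.pi) + ((p * n : ℤ) : ℝ) := by
    rw [sub_eq_iff_eq_add.1 hn]
    push_cast
    field_simp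
    ring
  rw [sector, h', Int.floor_add_intCast]
  simp

lemma sector_stdAddChar_mul {z : ℂ} (hz : z ≠ 0) (a : ZMod p) :
    sector p (ZMod.stdAddChar a * z) = sector p z + a := by
  have hp : (p : ℝ) ≠ 0 := by exact_mod_cast (Fact.out : p.Prime).ne_zero
  have hp' : (p : ℂ) ≠ 0 := by exact_mod_cast (Fact.out : p.Prime).ne_zero
  rw [sector_eq (θ := z.arg + 2 * Real.pi * a.val / p) (norm_pos_iff.2 hz)]
  · have h : p * (z.arg + 2 * Real.pi * a.val / p) / (2 * Real.pi) =
        p * z.arg / (2 * Real.pi) + ((a.val : ℤ) : ℝ) := by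
      push_cast
      field_simp
    rw [h, Int.floor_add_intCast, sector]
    simp
  · rw [ZMod.stdAddChar_apply, ZMod.toCircle_apply]
    conv_lhs => rw [← Complex.norm_mul_exp_arg_mul_I z]
    rw [mul_left_comm, ← Complex.exp_add]
    congr 2
    push_cast
    ring

lemma sector_mul {z w : ℂ} (hz : z ≠ 0) (hw : w ≠ 0) :
    sector p (z * w) = (⌊p * z.arg / (2 * Real.pi) + p * w.arg / (2 * Real.pi)⌋ : ℤ) := by
  rw [sector_eq (θ := z.arg + w.arg) (mul_pos (norm_pos_iff.2 hz) (norm_pos_iff.2 hw)),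
    mul_add, add_div]
  conv_lhs => rw [← Complex.norm_mul_exp_arg_mul_I z, ← Complex.norm_mul_exp_arg_mul_I w]
  push_cast
  rw [add_mul, Complex.exp_add]
  ring

lemma eventually_sector {z : ℂ} (hz : z ≠ 0) :
    ∃ j, ∀ᶠ w in 𝓝 z, sector p w = j ∨ sector p w = j + 1 := by
  set t := p * z.arg / (2 * Real.pi) with ht
  refine ⟨(⌊t - 1 / 2⌋ : ℤ), ?_⟩
  have h : Tendsto (fun w : ℂ => p * (w / z).arg / (2 * Real.pi)) (𝓝 z) (𝓝 0) := by
    have h1 : ContinuousAt (fun w : ℂ => p * (w / z).arg / (2 * Real.pi)) z := by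
      refine ContinuousAt.div_const (continuousAt_const.mul ?_) _
      refine ContinuousAt.comp (Complex.continuousAt_arg ?_) (continuousAt_id.div_const z)
      simp [hz]
    simpa [ContinuousAt, hz] using h1
  filter_upwards [Metric.tendsto_nhds.1 h (1 / 2) (by norm_num), isOpen_ne.mem_nhds hz]
    with w hw hw0
  rw [Real.dist_eq, sub_zero, abs_lt] at hw
  rw [← mul_div_cancel₀ w hz, sector_mul hz (div_ne_zero hw0 hz), ← ht]
  set u := p * (w / z).arg / (2 * Real.pi)
  have h1 := Int.floor_le (t - 1 / 2)
  have h2 := Int.lt_floor_add_one (t - 1 / 2)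
  have h3 : ⌊t + u⌋ = ⌊t - 1 / 2⌋ ∨ ⌊t + u⌋ = ⌊t - 1 / 2⌋ + 1 := by
    by_cases h : t + u < ⌊t - 1 / 2⌋ + 1
    · left
      rw [Int.floor_eq_iff]
      constructor <;> linarith
    · right
      rw [Int.floor_eq_iff]
      push_cast
      constructor <;> linarith
  rcases h3 with h3 | h3 <;> simp [h3]

end Sectors

section CommonZero

open Filter Topology

variable {E : Type*} [NormedAddCommGroup E] {p : ℕ} [Fact p.Prime]

open Classical in
/-- The sector of the value of `h`, or a default value where `h` vanishes. -/
noncomputable def sectorLabel (h : E → ℂ) (label : E → ZMod p) (v : E) : ZMod p :=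
  if h v = 0 then label v else sector p (h v)

lemma eventually_sectorLabel {K : Set E} {h : E → ℂ} (hh : ContinuousOn h K)
    (hre : p = 2 → ∀ v ∈ K, (h v).im = 0) (label : E → ZMod p) {y : E} (hy : y ∈ K)
    (hy0 : h y ≠ 0) :
    ∃ j, ∀ᶠ v in 𝓝[K] y, sectorLabel h label v = j ∨ p ≠ 2 ∧ sectorLabel h label v = j + 1 := by
  have hne : ∀ᶠ v in 𝓝[K] y, h v ≠ 0 := (hh y hy).eventually_ne hy0
  by_cases hp : p = 2
  · refine ⟨sector p (h y), ?_⟩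
    filter_upwards [hne, (hh y hy).eventually (eventually_sector_eq p hy0 (hre hp y hy)),
      self_mem_nhdsWithin] with v hv hv' hvK
    simp [sectorLabel, hv, hv' (hre hp v hvK)]
  · obtain ⟨j, hj⟩ := eventually_sector (p := p) hy0
    refine ⟨j, ?_⟩
    filter_upwards [hne, (hh y hy).eventually hj] with v hv hv'
    simpa [sectorLabel, hv, hp] using hv'

variable [NormedSpace ℝ E] (F : Type*) [Field F] [Fintype F]

variable (p) in
/-- There is a character of a finite field for which any family of sufficiently few equivariant
functions has a common zero. -/
lemma exists_common_zero [Algebra (ZMod p) F] : ∃ s : F →+ ZMod p, s ≠ 0 ∧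
    ∀ {𝒞 : Set (Set E)} {T : F → E →ₗ[ℝ] E} {e : ℕ → F → E} {N : ℕ},
    (∀ C ∈ 𝒞, Convex ℝ C) → IsCompact (⋃₀ 𝒞) →
    (∀ c : ℕ → F, ∃ C ∈ 𝒞, ∀ i ≤ N, e i (c i) ∈ C) → (∀ g i x, T g (e i x) = e i (x + g)) →
    ∀ (pos : E → F), (∀ g, ∀ v ∈ ⋃₀ 𝒞, pos (T g v) = pos v + g) →
    ∀ {ι : Type} [Fintype ι] (h : ι → E → ℂ) (a : ι → F), (∀ i, a i ≠ 0) →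
    (∀ i, ContinuousOn (h i) (⋃₀ 𝒞)) → (p = 2 → ∀ i, ∀ v ∈ ⋃₀ 𝒞, (h i v).im = 0) →
    (∀ i g, ∀ v ∈ ⋃₀ 𝒞, h i (T g v) = ZMod.stdAddChar (s (a i * g)) * h i v) →
    (if p = 2 then 1 else 2) * Fintype.card ι ≤ N → ∃ y ∈ ⋃₀ 𝒞, ∀ i, h i y = 0 := by
  obtain ⟨f₀, f₁, s, hf₀, hf₁, hf₀₁, hf₁₀, hd⟩ := exists_weights (p := p) F
  refine ⟨s, ?_, ?_⟩
  · rintro rfl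
    simpa [Detects] using (hd 1 one_ne_zero).1
  intro 𝒞 T e N h𝒞 hK he hT pos hpos ι _ h a ha hcont hre heq hN
  let bs : List ((E → ZMod p) × (F → ZMod p)) := Finset.univ.toList.map fun i : ι =>
    (sectorLabel (h i) fun v => s (a i * pos v), fun x => s (a i * x))
  obtain ⟨y, hy, hy'⟩ := exists_forall_not_eventually_label h𝒞 hK he hT hf₀ hf₁ hf₀₁ hf₁₀ bs
    (by
      simp only [bs, List.mem_map, Finset.mem_toList, Finset.mem_univ, true_and,
        forall_exists_index, forall_apply_eq_imp_iff]
      intro i g v hv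
      have hψ : (ZMod.stdAddChar (s (a i * g)) : ℂ) ≠ 0 := by simp [ZMod.stdAddChar_apply]
      by_cases h0 : h i v = 0
      · simp [sectorLabel, heq i g v hv, h0, hpos g v hv, mul_add]
      · simp [sectorLabel, heq i g v hv, h0, sector_stdAddChar_mul, hψ])
    (by
      simp only [bs, List.mem_map, Finset.mem_toList, Finset.mem_univ, true_and,
        forall_exists_index, forall_apply_eq_imp_iff]
      exact fun i => hd _ (ha i))
    (by simpa [bs] using hN)
  refine ⟨y, hy, fun i => ?_⟩
  by_contra h0
  obtain ⟨j, hj⟩ := eventually_sectorLabel (hcont i) (fun hp => hre hp i)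
    (fun v => s (a i * pos v)) hy h0
  exact hy' _ (List.mem_map.2 ⟨i, by simp, rfl⟩) j hj

end CommonZero

section Translate

variable {ι F : Type*} [AddCommGroup F]

/-- The action of `F` by translation of the second variable. -/
def translate (g : F) : (ι → F → ℝ) →ₗ[ℝ] (ι → F → ℝ) where
  toFun y i x := y i (x - g)
  map_add' _ _ := rfl
  map_smul' _ _ := rfl

lemma translate_apply (g : F) (y : ι → F → ℝ) (i : ι) (x : F) :
    translate g y i x = y i (x - g) := rfl

lemma translate_single [DecidableEq ι] [DecidableEq F] (g : F) (i : ι) (x : F) (t : ℝ) :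
    translate g (Pi.single i (Pi.single x t)) = Pi.single i (Pi.single (x + g) t) := by
  ext j z
  rw [translate_apply]
  by_cases hj : j = i
  · subst hj
    simp [Pi.single_apply, sub_eq_iff_eq_add]
  · simp [hj]

end Translate

section JoinComplex

open Filter Topology

variable {ι F : Type*} [Fintype ι]

/-- The total weight of the `x`-th column. -/
def mass (y : ι → F → ℝ) (x : F) : ℝ := ∑ i, y i x

/-- The `x`-th column, divided by its weight. -/
noncomputable def column (y : ι → F → ℝ) (x : F) : ι → ℝ := (mass y x)⁻¹ • fun i => y i x

lemma column_mem_stdSimplex {y : ι → F → ℝ} (hy : ∀ i x, 0 ≤ y i x) {x : F}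
    (hx : mass y x ≠ 0) : column y x ∈ stdSimplex ℝ ι := by
  refine ⟨fun i => ?_, ?_⟩
  · exact mul_nonneg (inv_nonneg.2 (Finset.sum_nonneg fun i _ => hy i x)) (hy i x)
  · simp only [column, Pi.smul_apply, smul_eq_mul, ← Finset.mul_sum]
    exact inv_mul_cancel₀ hx

/-- The value of `φ` on the `x`-th column, scaled by the weight of that column. -/
noncomputable def scaledValue (φ : (ι → ℝ) → ℝ) (y : ι → F → ℝ) (x : F) : ℝ :=
  mass y x * φ (column y x)

lemma continuousOn_scaledValue {φ : (ι → ℝ) → ℝ} (hφ : ContinuousOn φ (stdSimplex ℝ ι)) (x : F) :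
    ContinuousOn (fun y => scaledValue φ y x) {y : ι → F → ℝ | ∀ i x, 0 ≤ y i x} := by
  have hmass : Continuous fun y : ι → F → ℝ => mass y x := by
    unfold mass
    fun_prop
  intro y hy
  by_cases hx : mass y x = 0
  · obtain ⟨M, hM⟩ := (isCompact_stdSimplex ℝ ι).exists_bound_of_continuousOn hφ
    rw [ContinuousWithinAt, scaledValue, hx, zero_mul]
    have hlim : Tendsto (fun y => ‖mass y x‖ * M) (𝓝[{y : ι → F → ℝ | ∀ i x, 0 ≤ y i x}] y)
        (𝓝 0) := by
      have := (hmass.norm.mul_const M).continuousWithinAt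
        (s := {y : ι → F → ℝ | ∀ i x, 0 ≤ y i x}) (x := y)
      simpa [ContinuousWithinAt, hx] using this
    refine squeeze_zero_norm' ?_ hlim
    filter_upwards [self_mem_nhdsWithin] with v hv
    rw [scaledValue, norm_mul]
    by_cases h0 : mass v x = 0
    · simp [h0]
    · gcongr
      exact hM _ (column_mem_stdSimplex hv h0)
  · refine (continuousWithinAt_inter (hmass.continuousAt.eventually_ne hx)).1 ?_
    refine hmass.continuousWithinAt.mul ?_
    have hcol : ContinuousWithinAt (fun v : ι → F → ℝ => column v x)
        ({y | ∀ i x, 0 ≤ y i x} ∩ {v | mass v x ≠ 0}) y :=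
      (hmass.continuousWithinAt.inv₀ hx).smul
        (Continuous.continuousWithinAt (by fun_prop))
    exact ContinuousWithinAt.comp (t := stdSimplex ℝ ι) (f := fun v => column v x)
      (hφ _ (column_mem_stdSimplex hy hx)) hcol fun v hv => column_mem_stdSimplex hv.1 hv.2

section ColoredSimplex

variable [Fintype F]

/-- The simplex spanned by the points `(i, c i)`. -/
def coloredSimplex (c : ι → F) : Set (ι → F → ℝ) :=
  {y | (∀ i x, 0 ≤ y i x) ∧ ∑ i, ∑ x, y i x = 1 ∧ ∀ i x, x ≠ c i → y i x = 0}

lemma convex_coloredSimplex (c : ι → F) : Convex ℝ (coloredSimplex c) := by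
  rintro y ⟨hy, hy1, hyc⟩ z ⟨hz, hz1, hzc⟩ a b ha hb hab
  refine ⟨fun i x => ?_, ?_, fun i x hx => ?_⟩
  · have := hy i x
    have := hz i x
    simp only [Pi.add_apply, Pi.smul_apply, smul_eq_mul]
    positivity
  · simp [Finset.sum_add_distrib, ← Finset.mul_sum, hy1, hz1, hab]
  · simp [hyc i x hx, hzc i x hx]

lemma isCompact_coloredSimplex (c : ι → F) : IsCompact (coloredSimplex c) := by
  refine Metric.isCompact_of_isClosed_isBounded ?_ ?_
  · simp only [coloredSimplex, Set.ofPred_and, Set.ofPred_forall]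
    refine IsClosed.inter ?_ (IsClosed.inter ?_ ?_)
    · exact isClosed_iInter fun i => isClosed_iInter fun x =>
        isClosed_le continuous_const (by fun_prop)
    · exact isClosed_eq (by fun_prop) continuous_const
    · exact isClosed_iInter fun i => isClosed_iInter fun x => isClosed_iInter fun _ =>
        isClosed_eq (by fun_prop) continuous_const
  · refine (Metric.isBounded_Icc (0 : ι → F → ℝ) 1).subset ?_
    rintro y ⟨hy, hy1, -⟩
    refine ⟨fun i x => hy i x, fun i x => ?_⟩
    rw [Pi.one_apply, Pi.one_apply, ← hy1]
    exact (Finset.single_le_sum (fun x _ => hy i x) (Finset.mem_univ x)).trans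
      (Finset.single_le_sum (f := fun i => ∑ x, y i x)
        (fun i _ => Finset.sum_nonneg fun x _ => hy i x) (Finset.mem_univ i))

lemma single_mem_coloredSimplex [DecidableEq ι] [DecidableEq F] (c : ι → F) (i : ι) :
    Pi.single i (Pi.single (c i) 1) ∈ coloredSimplex c := by
  have h : ∀ j x, (Pi.single i (Pi.single (c i) 1) : ι → F → ℝ) j x =
      if j = i then if x = c i then 1 else 0 else 0 := fun j x => by
    by_cases hj : j = i
    · subst hj
      simp [Pi.single_apply]
    · simp [hj]
  refine ⟨fun j x => ?_, by simp [h], fun j x hx => ?_⟩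
  · rw [h]
    positivity
  · rw [h]
    split_ifs with h1 h2
    · exact absurd (h1 ▸ h2) hx
    · rfl
    · rfl

lemma exists_apply_ne_zero {c : ι → F} {y : ι → F → ℝ} (hy : y ∈ coloredSimplex c) :
    ∃ i, ∃ x, y i x ≠ 0 := by
  by_contra! h
  simpa [h] using hy.2.1

end ColoredSimplex

variable [AddCommGroup F]

lemma scaledValue_translate (φ : (ι → ℝ) → ℝ) (g : F) (y : ι → F → ℝ) (x : F) :
    scaledValue φ (translate g y) x = scaledValue φ y (x - g) := rfl

variable [Fintype F]

variable (ι F) in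
/-- There is an equivariant map from the complex to `F`. -/
lemma exists_equivariant : ∃ pos : (ι → F → ℝ) → F, ∀ (c : ι → F), ∀ y ∈ coloredSimplex c, ∀ g,
    pos (translate g y) = pos y + g := by
  classical
  by_cases hι : Nonempty ι
  swap
  · refine ⟨fun _ => 0, fun c y hy => ?_⟩
    obtain ⟨i, -⟩ := exists_apply_ne_zero hy
    exact absurd ⟨i⟩ hι
  let row (y : ι → F → ℝ) : ι := Classical.epsilon fun i => ∃ x, y i x ≠ 0
  let pos (y : ι → F → ℝ) : F := Classical.epsilon fun x => y (row y) x ≠ 0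
  refine ⟨pos, fun c y hy g => ?_⟩
  have hrow : row (translate g y) = row y := by
    simp only [row, translate_apply]
    congr 1
    ext i
    exact (Equiv.subRight g).exists_congr_left.trans (by simp)
  have h1 : ∃ x, y (row y) x ≠ 0 := Classical.epsilon_spec (exists_apply_ne_zero hy)
  have h2 : y (row y) (pos y) ≠ 0 := Classical.epsilon_spec h1
  have h3 : y (row y) (pos (translate g y) - g) ≠ 0 := by
    have : ∃ x, translate g y (row (translate g y)) x ≠ 0 := by
      obtain ⟨x, hx⟩ := h1
      exact ⟨x + g, by rwa [hrow, translate_apply, add_sub_cancel_right]⟩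
    have h5 : translate g y (row (translate g y)) (pos (translate g y)) ≠ 0 :=
      Classical.epsilon_spec this
    rwa [translate_apply, hrow] at h5
  have h4 : ∀ x, y (row y) x ≠ 0 → x = c (row y) := fun x hx => by
    by_contra h
    exact hx (hy.2.2 _ _ h)
  rw [← sub_eq_iff_eq_add, h4 _ h3, h4 _ h2]

end JoinComplex

section Fourier

variable {F : Type*} [Field F] [Fintype F] {p : ℕ}

lemma eq_of_sum_stdAddChar_eq_zero [Fact p.Prime] {s : F →+ ZMod p} (hs : s ≠ 0) {φ : F → ℝ}
    (h : ∀ a ≠ 0, ∑ x, (ZMod.stdAddChar (s (a * x)) : ℂ) * φ x = 0) (x z : F) : φ x = φ z := by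
  classical
  let χ : AddChar F ℂ := ZMod.stdAddChar.compAddMonoidHom s
  have hχ : χ.IsPrimitive := by
    refine AddChar.IsPrimitive.of_ne_one fun h1 => hs ?_
    ext x
    refine ZMod.injective_stdAddChar ?_
    simpa [χ] using DFunLike.congr_fun h1 x
  have key : ∀ z, (Fintype.card F : ℂ) * φ z = ∑ x, (φ x : ℂ) := fun z => by
    have h1 : ∀ a, ∑ x, χ (a * (x - z)) * φ x = if a = 0 then ∑ x, (φ x : ℂ) else 0 := fun a => by
      split_ifs with ha
      · simp [ha]
      · simp only [mul_sub, AddChar.map_sub_eq_div, div_mul_eq_mul_div]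
        rw [← Finset.sum_div]
        simp only [χ, AddChar.compAddMonoidHom_apply, h a ha, zero_div]
    have h2 : ∑ a, ∑ x, χ (a * (x - z)) * φ x = ∑ x, (φ x : ℂ) := by simp [h1]
    rw [← h2, Finset.sum_comm]
    simp only [← Finset.sum_mul, AddChar.sum_mulShift _ hχ, sub_eq_zero]
    simp
  have hF : (Fintype.card F : ℂ) ≠ 0 := by simp
  exact_mod_cast mul_left_cancel₀ hF ((key x).trans (key z).symm)

variable (F p) in
lemma exists_half [CharP F p] : ∃ S : Finset F, (∀ a ∈ S, a ≠ 0) ∧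
    (∀ a ≠ 0, a ∈ S ∨ -a ∈ S) ∧ (if p = 2 then 1 else 2) * S.card ≤ Fintype.card F - 1 := by
  classical
  have hcard : (Finset.univ.erase (0 : F)).card = Fintype.card F - 1 := by simp
  by_cases hp : p = 2
  · exact ⟨Finset.univ.erase 0, by simp, by simp, by simp [hp]⟩
  · have h2 : (2 : F) ≠ 0 := Ring.two_ne_zero (by rwa [ringChar.eq F p])
    let e := Fintype.equivFin F
    have hne : ∀ a : F, a ≠ 0 → a ≠ -a := fun a ha h => by
      have : 2 * a = 0 := by linear_combination h
      exact mul_ne_zero h2 ha this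
    let S : Finset F := Finset.univ.filter fun a => e a < e (-a)
    have hS0 : ∀ a ∈ S, a ≠ 0 := by
      rintro a ha rfl
      simp [S] at ha
    refine ⟨S, hS0, fun a ha => ?_, ?_⟩
    · have := e.injective.ne (hne a ha)
      simpa [S] using lt_or_gt_of_ne this
    · have hdisj : Disjoint S (S.image Neg.neg) := by
        rw [Finset.disjoint_left]
        intro a ha ha'
        obtain ⟨b, hb, rfl⟩ := Finset.mem_image.1 ha'
        simp only [S, Finset.mem_filter, Finset.mem_univ, true_and, neg_neg] at ha hb
        exact lt_asymm ha hb
      rw [if_neg hp, two_mul, ← hcard]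
      nth_rw 2 [← Finset.card_image_of_injective S neg_injective]
      rw [← Finset.card_union_of_disjoint hdisj]
      refine Finset.card_le_card fun a ha => ?_
      rcases Finset.mem_union.1 ha with ha | ha
      · simpa using hS0 a ha
      · obtain ⟨b, hb, rfl⟩ := Finset.mem_image.1 ha
        simpa using hS0 b hb

end Fourier

section Main

variable (F : Type) [Field F] [Fintype F]

lemma exists_scaledValue_eq (p : ℕ) [Fact p.Prime] [Algebra (ZMod p) F] {N : ℕ}
    {κ : Type} [Fintype κ]
    (hN : Fintype.card κ * (Fintype.card F - 1) ≤ N) {φ : κ → (Fin (N + 1) → ℝ) → ℝ}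
    (hφ : ∀ j, ContinuousOn (φ j) (stdSimplex ℝ (Fin (N + 1)))) :
    ∃ c : Fin (N + 1) → F, ∃ y ∈ coloredSimplex c, ∀ j x z,
      scaledValue (φ j) y x = scaledValue (φ j) y z := by
  classical
  have : CharP F p := charP_of_injective_algebraMap (algebraMap (ZMod p) F).injective p
  obtain ⟨s, hs, hzero⟩ := exists_common_zero (E := Fin (N + 1) → F → ℝ) p F
  obtain ⟨S, hS0, hS, hScard⟩ := exists_half F p
  obtain ⟨pos, hpos⟩ := exists_equivariant (Fin (N + 1)) F
  have hK : ⋃₀ Set.range (coloredSimplex (ι := Fin (N + 1)) (F := F)) ⊆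
      {y | ∀ i x, 0 ≤ y i x} := by
    rintro y ⟨_, ⟨c, rfl⟩, hy⟩
    exact hy.1
  let h (b : κ × S) (y : Fin (N + 1) → F → ℝ) : ℂ :=
    ∑ x, (ZMod.stdAddChar (s (b.2 * x)) : ℂ) * scaledValue (φ b.1) y x
  obtain ⟨y, ⟨_, ⟨c, rfl⟩, hy⟩, hy0⟩ := hzero (N := N) (𝒞 := Set.range coloredSimplex)
    (T := translate) (e := fun i x => Pi.single (Fin.ofNat (N + 1) i) (Pi.single x 1))
    (by rintro _ ⟨c, rfl⟩; exact convex_coloredSimplex c)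
    (by
      rw [Set.sUnion_range]
      exact isCompact_iUnion isCompact_coloredSimplex)
    (fun c => ⟨_, ⟨fun i => c i, rfl⟩, fun i hi => by
      convert single_mem_coloredSimplex (fun i : Fin (N + 1) => c i) (Fin.ofNat (N + 1) i)
      simp [Nat.mod_eq_of_lt (Nat.lt_succ_of_le hi)]⟩)
    (fun g i x => translate_single g _ x 1) pos
    (by rintro g y ⟨_, ⟨c, rfl⟩, hy⟩; exact hpos c y hy g)
    h (fun b => b.2) (fun b => hS0 _ b.2.2)
    (fun b => by
      refine continuousOn_finsetSum _ fun x _ => continuousOn_const.mul ?_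
      exact Complex.continuous_ofReal.comp_continuousOn
        ((continuousOn_scaledValue (hφ b.1) x).mono hK))
    (fun hp b v _ => by
      subst hp
      have : ∀ a : ZMod 2, (ZMod.stdAddChar a : ℂ).im = 0 := fun a => by
        rw [← Complex.conj_eq_iff_im, ← AddChar.map_neg_eq_conj, ZModModule.neg_eq_self]
      simp [h, this])
    (fun b g v _ => by
      simp only [h, Finset.mul_sum, scaledValue_translate]
      rw [← Equiv.sum_comp (Equiv.addRight g)]
      refine Finset.sum_congr rfl fun x _ => ?_
      simp only [Equiv.coe_addRight, add_sub_cancel_right, mul_add, map_add, AddChar.map_add_eq_mul]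
      ring)
    (by
      rw [Fintype.card_prod, Fintype.card_coe, mul_left_comm]
      exact (Nat.mul_le_mul_left _ hScard).trans hN)
  refine ⟨c, y, hy, fun j => eq_of_sum_stdAddChar_eq_zero hs fun a ha => ?_⟩
  rcases hS a ha with ha' | ha'
  · exact hy0 (j, ⟨a, ha'⟩)
  · have := congrArg (starRingEnd ℂ) (hy0 (j, ⟨-a, ha'⟩))
    simpa [h, map_sum, ← AddChar.map_neg_eq_conj] using this

/-- The topological Tverberg theorem, with faces indexed by a finite field. -/
lemma exists_faces (p : ℕ) [Fact p.Prime] [Algebra (ZMod p) F] {N d : ℕ}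
    (hN : (d + 1) * (Fintype.card F - 1) ≤ N)
    {f : (Fin (N + 1) → ℝ) → EuclideanSpace ℝ (Fin d)}
    (hf : ContinuousOn f (stdSimplex ℝ (Fin (N + 1)))) :
    ∃ A : F → Set (Fin (N + 1)), (∀ x, (A x).Nonempty) ∧ (∀ x z, x ≠ z → Disjoint (A x) (A z)) ∧
      (⋂ x, f '' {v ∈ stdSimplex ℝ (Fin (N + 1)) | ∀ i ∉ A x, v i = 0}).Nonempty := by
  obtain ⟨c, y, ⟨hy, hy1, hyc⟩, hval⟩ := exists_scaledValue_eq F p (κ := Option (Fin d))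
    (by simpa using hN) (φ := fun j v => j.elim 1 fun j => f v j)
    (by
      rintro (_ | j)
      · exact continuousOn_const
      · exact (EuclideanSpace.proj (𝕜 := ℝ) j).continuous.comp_continuousOn hf)
  have hmass : ∀ x z, mass y x = mass y z := fun x z => by
    simpa [scaledValue] using hval none x z
  have hne : ∀ x, mass y x ≠ 0 := fun x h0 => by
    rw [Finset.sum_comm] at hy1
    have : ∀ z, ∑ i, y i z = 0 := fun z => (hmass z x).trans h0
    simp [this] at hy1
  refine ⟨fun x => {i | c i = x}, fun x => ?_, fun x z hxz => ?_, f (column y 0), ?_⟩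
  · obtain ⟨i, -, hi⟩ := Finset.exists_ne_zero_of_sum_ne_zero (hne x)
    exact ⟨i, by_contra fun h => hi (hyc i x (Ne.symm h))⟩
  · rw [Set.disjoint_left]
    rintro i rfl hi
    exact hxz hi
  · refine Set.mem_iInter.2 fun x => ⟨column y x, ⟨column_mem_stdSimplex hy (hne x), ?_⟩, ?_⟩
    · intro i hi
      simp [column, hyc i x (Ne.symm hi)]
    · ext j
      have := hval (some j) x 0
      rw [scaledValue, scaledValue, hmass x 0] at this
      exact mul_left_cancel₀ (hne 0) this

end Main

end TopologicalTverberg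

/-- Topological Tverberg theorem for prime powers: if `r` is a prime power and `d > 0`,
then for every continuous map of the `(d+1)(r-1)`-simplex to `ℝ^d` there exist `r`
pairwise disjoint faces whose images have a common point. -/
theorem stmt_15 (d r : ℕ) (hd : 0 < d)
    (hr : ∃ q m : ℕ, Nat.Prime q ∧ 1 ≤ m ∧ r = q ^ m)
    (f : (Fin ((d + 1) * (r - 1) + 1) → ℝ) → EuclideanSpace ℝ (Fin d))
    (hf : ContinuousOn f (stdSimplex ℝ (Fin ((d + 1) * (r - 1) + 1)))) :
    ∃ A : Fin r → Set (Fin ((d + 1) * (r - 1) + 1)),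
      (∀ s : Fin r, (A s).Nonempty) ∧
      (∀ s t : Fin r, s ≠ t → Disjoint (A s) (A t)) ∧
      (⋂ s : Fin r,
        f '' {x ∈ stdSimplex ℝ (Fin ((d + 1) * (r - 1) + 1)) |
          ∀ i ∉ A s, x i = 0}).Nonempty := by
  obtain ⟨p, m, hp, hm, rfl⟩ := hr
  have : Fact p.Prime := ⟨hp⟩
  have : Fintype (GaloisField p m) := Fintype.ofFinite _
  have hcard : Fintype.card (GaloisField p m) = p ^ m := by
    rw [← Nat.card_eq_fintype_card, GaloisField.card p m (by omega)]
  obtain ⟨A, hA, hdisj, z, hz⟩ := TopologicalTverberg.exists_faces (GaloisField p m) p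
    (by rw [hcard]) hf
  let e := (Fintype.equivFinOfCardEq hcard).symm
  exact ⟨fun s => A (e s), fun s => hA _, fun s t hst => hdisj _ _ (e.injective.ne hst), z,
    Set.mem_iInter.2 fun s => Set.mem_iInter.1 hz (e s)⟩
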